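/- arXiv:1602.00935 — 2 statements merged into one kernel-verified Lean document; each statement's English description precedes it below -/
import Mathlib

section
/- Let D be a connected simple digraph on {1,…,n} with n ≥ 2. Then every α ∈ ⟨D⟩ satisfies cycl(α) = 0 if and only if D has no subdigraph isomorphic to Γ1, Γ2, Γ3, Γ4, or to the directed cycle Θ_k for any k ≥ 5. -/
noncomputable section

variable {V : Type*}

/-- The arc `(a→b)`: the map sending `a` to `b` and fixing every other point. -/
def arcMap [DecidableEq V] (a b : V) : V → V := fun x => if x = a then b else x

/-- Evaluate a word of arcs, applying the arcs from left to right. -/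
def wordEval [DecidableEq V] (w : List (V × V)) : V → V :=
  fun x => w.foldl (fun y e => arcMap e.1 e.2 y) x

/-- `α ∈ ⟨D⟩`: `α` is a (nonempty) product of arcs of the digraph `D`. -/
def InGen [DecidableEq V] (D : V → V → Prop) (α : V → V) : Prop :=
  ∃ w : List (V × V), w ≠ [] ∧ (∀ e ∈ w, D e.1 e.2) ∧ wordEval w = α

/-- `ℓ(D, α)`: the minimal length of a word in the arcs of `D` expressing `α`. -/
def arcLen [DecidableEq V] (D : V → V → Prop) (α : V → V) : ℕ :=
  sInf {k | ∃ w : List (V × V), w.length = k ∧ (∀ e ∈ w, D e.1 e.2) ∧ wordEval w = α}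

/-- `fix(α)`: the number of fixed points of `α`. -/
def fixCnt (α : V → V) : ℕ := Set.ncard {x | α x = x}

/-- `rk(α)`: the rank of `α`, i.e. the cardinality of its image. -/
def rnk (α : V → V) : ℕ := Set.ncard (Set.range α)

/-- A set `C` is a cyclic orbit of `α` if it is a weakly connected component of the
functional digraph of `α` (edges `(x, α x)`) which is a directed cycle on at least two
vertices: equivalently, `C` is the forward orbit of a periodic point, has at least two
elements, and is closed under taking preimages. -/
def IsCyclicOrbit (α : V → V) (C : Set V) : Prop :=
  2 ≤ C.ncard ∧ (∃ x ∈ C, (∃ k, 0 < k ∧ α^[k] x = x) ∧ C = {y | ∃ k, α^[k] x = y}) ∧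
    ∀ y : V, α y ∈ C → y ∈ C

/-- `cycl(α)`: the number of cyclic orbits of `α`. -/
def cyclCnt (α : V → V) : ℕ := Set.ncard {C : Set V | IsCyclicOrbit α C}

/-- `D` is connected: any two vertices are joined by a directed path in some direction. -/
def ConnectedDigraph (D : V → V → Prop) : Prop :=
  ∀ u v : V, Relation.ReflTransGen D u v ∨ Relation.ReflTransGen D v u

/-- `D` is closed (equal to its closure): whenever `(b,a)` is an edge lying on a directed
cycle of `D` (i.e. there is a directed path from `a` back to `b`), `(a,b)` is also an edge. -/
def ClosedDigraph (D : V → V → Prop) : Prop :=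
  ∀ a b : V, D b a → Relation.ReflTransGen D a b → D a b

/-- Property (★): if `v0, v1, v2` is a directed path with `d_D(v0,v2) = 2`, then every
out-neighbour of `v1` and of `v2` lies in `{v0, v1, v2}`. -/
def StarCond (D : V → V → Prop) : Prop :=
  ∀ v0 v1 v2 : V, D v0 v1 → D v1 v2 → v0 ≠ v2 → ¬ D v0 v2 →
    ∀ u : V, (D v1 u ∨ D v2 u) → (u = v0 ∨ u = v1 ∨ u = v2)

/-- `C` is a strong component of `D`. -/
def IsSC (D : V → V → Prop) (C : Set V) : Prop :=
  ∃ v : V, C = {u | Relation.ReflTransGen D u v ∧ Relation.ReflTransGen D v u}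

/-- `C1` connects to `C2`: some edge goes from `C1` to `C2`. -/
def ConnectsTo (D : V → V → Prop) (C1 C2 : Set V) : Prop :=
  ∃ v1 ∈ C1, ∃ v2 ∈ C2, D v1 v2

/-- `C1` fully connects to `C2`: all pairs are edges. -/
def FullyConnects (D : V → V → Prop) (C1 C2 : Set V) : Prop :=
  ∀ v1 ∈ C1, ∀ v2 ∈ C2, D v1 v2

/-- A terminal strong component: it connects to no other strong component. -/
def IsTerminalSC (D : V → V → Prop) (C : Set V) : Prop :=
  IsSC D C ∧ ∀ C' : Set V, IsSC D C' → C' ≠ C → ¬ ConnectsTo D C C'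

/-- Property (★★): nonterminal strong components have at most 2 vertices and terminal
strong components have at most 3 vertices. -/
def StarStarCond (D : V → V → Prop) : Prop :=
  ∀ C : Set V, IsSC D C →
    (IsTerminalSC D C → C.ncard ≤ 3) ∧ (¬ IsTerminalSC D C → C.ncard ≤ 2)

/-- The induced subdigraph on `C` is an undirected path `a - b - c` on three vertices. -/
def IsP3 (D : V → V → Prop) (C : Set V) : Prop :=
  ∃ a b c : V, a ≠ b ∧ b ≠ c ∧ a ≠ c ∧ C = {a, b, c} ∧
    ∀ u ∈ C, ∀ w ∈ C,
      (D u w ↔ (u = a ∧ w = b) ∨ (u = b ∧ w = a) ∨ (u = b ∧ w = c) ∨ (u = c ∧ w = b))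

/-- `D` has a subdigraph isomorphic to `H`: an injection mapping edges of `H` to edges of `D`. -/
def HasSubdigraph (D : V → V → Prop) {m : ℕ} (H : Fin m → Fin m → Prop) : Prop :=
  ∃ f : Fin m → V, Function.Injective f ∧ ∀ i j : Fin m, H i j → D (f i) (f j)

/-- `Θ_k`: the directed cycle on `k` vertices. -/
def Theta (k : ℕ) : Fin k → Fin k → Prop := fun i j => (j : ℕ) = ((i : ℕ) + 1) % k

/-- `Γ1` (vertices relabelled from `{1,…,5}` to `{0,…,4}`). -/
def Gamma1 : Fin 5 → Fin 5 → Prop := fun i j =>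
  ((i : ℕ), (j : ℕ)) ∈ [(0,3),(3,0),(1,3),(3,1),(2,3),(3,2),(3,4)]

/-- `Γ2` (vertices relabelled from `{1,…,5}` to `{0,…,4}`). -/
def Gamma2 : Fin 5 → Fin 5 → Prop := fun i j =>
  ((i : ℕ), (j : ℕ)) ∈ [(0,2),(2,0),(1,2),(2,1),(2,3),(3,2),(3,4)]

/-- `Γ3` (vertices relabelled from `{1,…,4}` to `{0,…,3}`). -/
def Gamma3 : Fin 4 → Fin 4 → Prop := fun i j =>
  ((i : ℕ), (j : ℕ)) ∈ [(0,1),(1,2),(2,0),(2,3)]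

/-- `Γ4` (vertices relabelled from `{1,…,5}` to `{0,…,4}`). -/
def Gamma4 : Fin 5 → Fin 5 → Prop := fun i j =>
  ((i : ℕ), (j : ℕ)) ∈ [(0,1),(1,2),(2,3),(3,0),(3,4)]

/-- No subdigraph isomorphic to `Γ1`, `Γ2`, `Γ3`, `Γ4` or `Θ_k` for `k ≥ 5`. -/
def ForbiddenFree (D : V → V → Prop) : Prop :=
  ¬ HasSubdigraph D Gamma1 ∧ ¬ HasSubdigraph D Gamma2 ∧ ¬ HasSubdigraph D Gamma3 ∧
    ¬ HasSubdigraph D Gamma4 ∧ ∀ k : ℕ, 5 ≤ k → ¬ HasSubdigraph D (Theta k)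

/-- `D` is acyclic: it has no directed cycle. -/
def AcyclicRel (D : V → V → Prop) : Prop := ∀ v : V, ¬ Relation.TransGen D v v

/-- `ψ_A(u,w)`: the maximal number of edges of a directed path from `u` to `w` in `A`
(in particular `ψ_A(u,u) = 0`). -/
def psiLongest (A : V → V → Prop) (u w : V) : ℕ :=
  sSup {l | ∃ p : List V, p.Chain' A ∧ p.Nodup ∧
    p.head? = some u ∧ p.getLast? = some w ∧ p.length = l + 1}

/-- `d_D(u,w)`: the minimal number of edges of a directed path from `u` to `w` in `D`. -/
def ddist (D : V → V → Prop) (u w : V) : ℕ :=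
  sInf {l | ∃ p : List V, p.Chain' D ∧ p.head? = some u ∧ p.getLast? = some w ∧
    p.length = l + 1}

/-- A tournament: no loops, and exactly one of `(u,v)`, `(v,u)` is an edge for `u ≠ v`. -/
def IsTournament (D : V → V → Prop) : Prop :=
  (∀ v : V, ¬ D v v) ∧ ∀ u v : V, u ≠ v → (D u v ∨ D v u) ∧ ¬ (D u v ∧ D v u)

/-- A strong (strongly connected) digraph. -/
def IsStrongDigraph (D : V → V → Prop) : Prop :=
  ∀ u v : V, Relation.ReflTransGen D u v

/-- `D` has a word, possibly empty, evaluating to `β`. -/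
def IsWordMap [DecidableEq V] (D : V → V → Prop) (β : V → V) : Prop :=
  ∃ w : List (V × V), (∀ e ∈ w, D e.1 e.2) ∧ wordEval w = β

/-- Along the forward orbit of `x`, the map `α` has singleton fibres. -/
def InjAlongOrbit (α : V → V) (x : V) : Prop :=
  ∀ i y, α y = α (α^[i] x) → y = α^[i] x

/-- `s` lies on a directed triangle. -/
def OnTriangle (D : V → V → Prop) (s : V) : Prop :=
  ∃ a b, D s a ∧ D a b ∧ D b s ∧ s ≠ a ∧ s ≠ b ∧ a ≠ b

/-- `s` lies on a directed cycle with four vertices. -/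
def OnSquare (D : V → V → Prop) (s : V) : Prop :=
  ∃ a b c, D s a ∧ D a b ∧ D b c ∧ D c s ∧ s ≠ a ∧ s ≠ b ∧ s ≠ c ∧ a ≠ b ∧ a ≠ c ∧ b ≠ c

/-- `s` is the centre of a bidirected star with three leaves. -/
def IsClawCentre (D : V → V → Prop) (s : V) : Prop :=
  ∃ a b c, D s a ∧ D a s ∧ D s b ∧ D b s ∧ D s c ∧ D c s ∧ a ≠ b ∧ a ≠ c ∧ b ≠ c

section Words

variable [DecidableEq V]

lemma wordEval_append (u w : List (V × V)) (x : V) :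
    wordEval (u ++ w) x = wordEval w (wordEval u x) := by
  simp [wordEval]

lemma wordEval_concat (u : List (V × V)) (e : V × V) (x : V) :
    wordEval (u ++ [e]) x = arcMap e.1 e.2 (wordEval u x) := by
  simp [wordEval]

lemma IsWordMap.id (D : V → V → Prop) : IsWordMap D id :=
  ⟨[], by simp, rfl⟩

lemma IsWordMap.comp {D : V → V → Prop} {β γ : V → V} (hγ : IsWordMap D γ)
    (hβ : IsWordMap D β) : IsWordMap D (γ ∘ β) := by
  obtain ⟨u, hu, rfl⟩ := hβ
  obtain ⟨w, hw, rfl⟩ := hγ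
  refine ⟨u ++ w, ?_, funext fun x => wordEval_append u w x⟩
  intro e he
  rcases List.mem_append.1 he with h | h
  exacts [hu e h, hw e h]

lemma IsWordMap.arc {D : V → V → Prop} {a b : V} (h : D a b) : IsWordMap D (arcMap a b) :=
  ⟨[(a, b)], by simpa using h, rfl⟩

lemma IsWordMap.inGen {D : V → V → Prop} {β : V → V} (h : IsWordMap D β) (hβ : β ≠ _root_.id) :
    InGen D β := by
  obtain ⟨w, hw, rfl⟩ := h
  refine ⟨w, ?_, hw, rfl⟩
  rintro rfl
  exact hβ rfl

lemma reflTransGen_wordEval {D : V → V → Prop} (w : List (V × V)) (hw : ∀ e ∈ w, D e.1 e.2)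
    (x : V) : Relation.ReflTransGen D x (wordEval w x) := by
  induction w using List.reverseRecOn with
  | nil => exact .refl
  | append_singleton u e ih =>
    rw [wordEval_concat]
    have h := ih fun e he => hw e (by simp [he])
    unfold arcMap
    split_ifs with hx
    · rw [hx] at h
      exact h.tail (hw e (by simp))
    · exact h

lemma wordEval_map {m : ℕ} (f : Fin m → V) (hf : Function.Injective f)
    (w : List (Fin m × Fin m)) (i : Fin m) :
    wordEval (w.map (Prod.map f f)) (f i) = f (wordEval w i) := by
  induction w using List.reverseRecOn with
  | nil => rfl
  | append_singleton u e ih =>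
    rw [List.map_append, List.map_singleton, wordEval_concat, wordEval_concat, ih]
    simp only [arcMap, Prod.map_fst, Prod.map_snd, hf.eq_iff]
    split_ifs <;> rfl

lemma wordEval_map_of_notMem {m : ℕ} (f : Fin m → V) (w : List (Fin m × Fin m)) (v : V)
    (hv : ∀ i, v ≠ f i) : wordEval (w.map (Prod.map f f)) v = v := by
  induction w using List.reverseRecOn with
  | nil => rfl
  | append_singleton u e ih =>
    rw [List.map_append, List.map_singleton, wordEval_concat, ih]
    simp [arcMap, hv]

end Words

section Swaps

lemma cyclCnt_ne_zero_of_swap [Finite V] {β : V → V} {a b : V} (hab : a ≠ b) (ha : β a = b)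
    (hb : β b = a) (ha' : ∀ y, β y = a → y = b) (hb' : ∀ y, β y = b → y = a) :
    cyclCnt β ≠ 0 := by
  have hC : IsCyclicOrbit β {a, b} := by
    refine ⟨(Set.ncard_pair hab).ge, ⟨a, by simp, ⟨2, by simp, by simp [ha, hb]⟩, ?_⟩, ?_⟩
    · ext y
      constructor
      · rintro (rfl | rfl)
        · exact ⟨0, rfl⟩
        · exact ⟨1, ha⟩
      · rintro ⟨k, rfl⟩
        induction k with
        | zero => simp
        | succ k ih =>
          rw [Function.iterate_succ_apply']
          rcases ih with h | h
          · rw [h, ha]; simp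
          · rw [Set.mem_singleton_iff.1 h, hb]; simp
    · rintro y (h | h)
      · exact Or.inr (ha' y h)
      · exact Or.inl (hb' y h)
  intro h
  rw [cyclCnt, Set.ncard_eq_zero (Set.toFinite _)] at h
  exact (Set.mem_empty_iff_false _).1 (h ▸ hC : ({a, b} : Set V) ∈ (∅ : Set (Set V)))

lemma exists_inGen_of_swap [Finite V] [DecidableEq V] {D : V → V → Prop} {β : V → V}
    (hβ : IsWordMap D β) {a b : V} (hab : a ≠ b) (ha : β a = b)
    (hb : β b = a) (ha' : ∀ y, β y = a → y = b) (hb' : ∀ y, β y = b → y = a) :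
    ∃ α, InGen D α ∧ cyclCnt α ≠ 0 :=
  ⟨β, hβ.inGen (by rintro rfl; exact hab ha), cyclCnt_ne_zero_of_swap hab ha hb ha' hb'⟩

lemma exists_inGen_of_hasSubdigraph [Finite V] [DecidableEq V] {D : V → V → Prop} {m : ℕ}
    {H : Fin m → Fin m → Prop} (hH : HasSubdigraph D H) (w : List (Fin m × Fin m))
    (hw : ∀ e ∈ w, H e.1 e.2) (a b : Fin m) (hab : a ≠ b) (ha : wordEval w a = b)
    (hb : wordEval w b = a) (ha' : ∀ y, wordEval w y = a → y = b)
    (hb' : ∀ y, wordEval w y = b → y = a) : ∃ α, InGen D α ∧ cyclCnt α ≠ 0 := by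
  obtain ⟨f, hf, hD⟩ := hH
  have key : ∀ c d : Fin m, (∀ y, wordEval w y = c → y = d) →
      ∀ y, wordEval (w.map (Prod.map f f)) y = f c → y = f d := by
    intro c d h y hy
    by_cases hr : ∃ i, y = f i
    · obtain ⟨i, rfl⟩ := hr
      rw [wordEval_map f hf] at hy
      rw [h i (hf hy)]
    · push Not at hr
      rw [wordEval_map_of_notMem f w y hr] at hy
      exact absurd hy (hr c)
  refine exists_inGen_of_swap (β := wordEval (w.map (Prod.map f f))) ⟨_, ?_, rfl⟩
    (hf.ne hab) ?_ ?_ (key _ _ ha') (key _ _ hb')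
  · intro e he
    obtain ⟨e', he', rfl⟩ := List.mem_map.1 he
    exact hD _ _ (hw e' he')
  · rw [wordEval_map f hf, ha]
  · rw [wordEval_map f hf, hb]

lemma exists_inGen_of_gamma1 [Finite V] [DecidableEq V] {D : V → V → Prop}
    (h : HasSubdigraph D Gamma1) : ∃ α, InGen D α ∧ cyclCnt α ≠ 0 :=
  exists_inGen_of_hasSubdigraph h
    [(3, 4), (2, 3), (3, 4), (0, 3), (3, 2), (1, 3), (3, 0), (2, 3), (3, 1)]
    (by unfold Gamma1; decide) 0 1 (by decide) (by decide) (by decide) (by decide) (by decide)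

lemma exists_inGen_of_gamma2 [Finite V] [DecidableEq V] {D : V → V → Prop}
    (h : HasSubdigraph D Gamma2) : ∃ α, InGen D α ∧ cyclCnt α ≠ 0 :=
  exists_inGen_of_hasSubdigraph h
    [(3, 4), (2, 3), (3, 4), (0, 2), (2, 3), (1, 2), (2, 0), (3, 2), (2, 1)]
    (by unfold Gamma2; decide) 0 1 (by decide) (by decide) (by decide) (by decide) (by decide)

lemma exists_inGen_of_gamma3 [Finite V] [DecidableEq V] {D : V → V → Prop}
    (h : HasSubdigraph D Gamma3) : ∃ α, InGen D α ∧ cyclCnt α ≠ 0 :=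
  exists_inGen_of_hasSubdigraph h [(2, 3), (1, 2), (0, 1), (2, 0)]
    (by unfold Gamma3; decide) 0 1 (by decide) (by decide) (by decide) (by decide) (by decide)

lemma exists_inGen_of_gamma4 [Finite V] [DecidableEq V] {D : V → V → Prop}
    (h : HasSubdigraph D Gamma4) : ∃ α, InGen D α ∧ cyclCnt α ≠ 0 :=
  exists_inGen_of_hasSubdigraph h [(3, 4), (2, 3), (3, 4), (1, 2), (2, 3), (0, 1), (3, 0)]
    (by unfold Gamma4; decide) 0 1 (by decide) (by decide) (by decide) (by decide) (by decide)

/-- Pushing everything on the directed path `g 4, …, g (j - 1)` forward to `g j`. -/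
lemma exists_isWordMap_sweep [DecidableEq V] {D : V → V → Prop} {k : ℕ} (g : ℕ → V)
    (hg : Set.InjOn g (Set.Iio k)) (hD : ∀ i, i < k → D (g i) (g (i + 1))) (j : ℕ) (hj : j ≤ k) :
    ∃ β, IsWordMap D β ∧ (∀ i, 4 ≤ i → i < j → β (g i) = g j) ∧
      ∀ v, (∀ i, 4 ≤ i → i < j → v ≠ g i) → β v = v := by
  induction j with
  | zero => exact ⟨id, .id D, by simp, by simp⟩
  | succ j ih =>
    obtain ⟨β, hβ, hin, hout⟩ := ih (by omega)
    by_cases h4 : 4 ≤ j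
    · refine ⟨arcMap (g j) (g (j + 1)) ∘ β, (IsWordMap.arc (hD j (by omega))).comp hβ, ?_, ?_⟩
      · intro i hi hij
        have : β (g i) = g j := by
          rcases Nat.lt_succ_iff_lt_or_eq.1 hij with h | rfl
          · exact hin i hi h
          · exact hout _ fun t _ ht e => by
              have := hg (by simp; omega) (by simp; omega) e
              omega
        simp [arcMap, this]
      · intro v hv
        have h1 : β v = v := hout v fun i hi hij => hv i hi (by omega)
        simp [arcMap, h1, hv j h4 (by omega)]
    · exact ⟨id, .id D, fun i _ _ => by omega, fun v _ => rfl⟩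

lemma exists_inGen_of_theta [Finite V] [DecidableEq V] {D : V → V → Prop} {k : ℕ} (hk : 5 ≤ k)
    (h : HasSubdigraph D (Theta k)) : ∃ α, InGen D α ∧ cyclCnt α ≠ 0 := by
  obtain ⟨f, hf, hD⟩ := h
  have hpos : 0 < k := by omega
  obtain ⟨g, hgdef⟩ : ∃ g : ℕ → V, ∀ i, g i = f ⟨i % k, Nat.mod_lt _ hpos⟩ := ⟨_, fun _ => rfl⟩
  have hgD : ∀ i, i < k → D (g i) (g (i + 1)) := by
    intro i _
    rw [hgdef, hgdef]
    exact hD _ _ (by simp [Theta])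
  have hginj : Set.InjOn g (Set.Iio k) := by
    intro i hi j hj e
    rw [hgdef, hgdef] at e
    have := congrArg Fin.val (hf e)
    simpa [Nat.mod_eq_of_lt hi, Nat.mod_eq_of_lt hj] using this
  have hgk : g k = g 0 := by simp [hgdef]
  have hne : ∀ i j, i < k → j < k → i ≠ j → g i ≠ g j := fun i j hi hj hij e =>
    hij (hginj hi hj e)
  obtain ⟨s, hs, hsin, hsout⟩ := exists_isWordMap_sweep g hginj hgD k le_rfl
  rw [hgk] at hsin
  have hs4 : ∀ i, i < 4 → s (g i) = g i := fun i hi =>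
    hsout _ fun t ht htk => hne _ _ (by omega) htk (by omega)
  obtain ⟨r, hrdef⟩ : ∃ r : V → V, r = s ∘ arcMap (g 0) (g 1) ∘ arcMap (g 1) (g 2) ∘
    arcMap (g 2) (g 3) ∘ arcMap (g 3) (g 4) := ⟨_, rfl⟩
  have hr : IsWordMap D r := by
    rw [hrdef]
    exact hs.comp ((IsWordMap.arc (hgD 0 (by omega))).comp
      ((IsWordMap.arc (hgD 1 (by omega))).comp
      ((IsWordMap.arc (hgD 2 (by omega))).comp (IsWordMap.arc (hgD 3 (by omega))))))
  have h01 := hne 0 1 (by omega) (by omega) (by omega)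
  have h02 := hne 0 2 (by omega) (by omega) (by omega)
  have h03 := hne 0 3 (by omega) (by omega) (by omega)
  have h04 := hne 0 4 (by omega) (by omega) (by omega)
  have h12 := hne 1 2 (by omega) (by omega) (by omega)
  have h13 := hne 1 3 (by omega) (by omega) (by omega)
  have h14 := hne 1 4 (by omega) (by omega) (by omega)
  have h23 := hne 2 3 (by omega) (by omega) (by omega)
  have h24 := hne 2 4 (by omega) (by omega) (by omega)
  have h34 := hne 3 4 (by omega) (by omega) (by omega)
  have r0 : r (g 0) = g 1 := by
    simp [hrdef, arcMap, h01, h02, h03, hs4]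
  have r1 : r (g 1) = g 2 := by
    simp [hrdef, arcMap, h12, h13, h02.symm, hs4]
  have r2 : r (g 2) = g 3 := by
    simp [hrdef, arcMap, h23, h13.symm, h03.symm, hs4]
  have r3 : r (g 3) = g 0 := by
    simp [hrdef, arcMap, h04.symm, h14.symm, h24.symm, hsin 4 le_rfl (by omega)]
  have rout : ∀ v, (∀ i, v ≠ g i) → r v = v := by
    intro v hv
    simp [hrdef, arcMap, hv, hsout v fun i _ _ => hv i]
  have a1 : (r ∘ r ∘ s) (g 1) = g 3 := by simp [hs4, r1, r2]
  have a3 : (r ∘ r ∘ s) (g 3) = g 1 := by simp [hs4, r0, r3]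
  have fibre : ∀ c d : ℕ, c ≠ 0 → c ≠ 2 → c < k → (∀ i, i < 4 → r (r (g i)) = g c → i = d) →
      ∀ y, (r ∘ r ∘ s) y = g c → y = g d := by
    intro c d hc0 hc2 hck hcd y hy
    by_cases hrange : ∃ i, y = g i
    · obtain ⟨i, hi⟩ := hrange
      obtain ⟨i, hik, rfl⟩ : ∃ i, i < k ∧ y = g i :=
        ⟨i % k, Nat.mod_lt _ hpos, by rw [hi, hgdef, hgdef]; simp⟩
      by_cases hi4 : i < 4
      · simp only [Function.comp_apply, hs4 i hi4] at hy
        rw [hcd i hi4 hy]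
      · simp only [Function.comp_apply, hsin i (by omega) hik, r0, r1] at hy
        exact absurd hy (hne _ _ (by omega) hck (by omega))
    · push Not at hrange
      simp only [Function.comp_apply, hsout y fun i _ _ => hrange i, rout y hrange] at hy
      exact absurd hy (hrange c)
  refine exists_inGen_of_swap (hr.comp (hr.comp hs)) h13 a1 a3
    (fibre 1 3 (by omega) (by omega) (by omega) ?_) (fibre 3 1 (by omega) (by omega) (by omega) ?_)
  · intro i hi e
    interval_cases i
    · rw [r0, r1] at e; exact absurd e.symm h12
    · rw [r1, r2] at e; exact absurd e.symm h13
    · rw [r2, r3] at e; exact absurd e h01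
    · rfl
  · intro i hi e
    interval_cases i
    · rw [r0, r1] at e; exact absurd e h23
    · rfl
    · rw [r2, r3] at e; exact absurd e h03
    · rw [r3, r0] at e; exact absurd e h13

end Swaps

section ClosedSets

lemma exists_injAlongOrbit_of_isCyclicOrbit {α : V → V} {C : Set V} (hC : IsCyclicOrbit α C) :
    ∃ x k, 0 < k ∧ α^[k] x = x ∧ α x ≠ x ∧ InjAlongOrbit α x := by
  obtain ⟨hcard, ⟨x, -, ⟨k, hk, hkx⟩, rfl⟩, hback⟩ := hC
  refine ⟨x, k, hk, hkx, ?_, ?_⟩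
  · intro hx
    have : {y | ∃ k, α^[k] x = y} = {x} := by
      ext y
      simp [Function.iterate_fixed hx, eq_comm]
    rw [this, Set.ncard_singleton] at hcard
    omega
  · intro i y hy
    obtain ⟨j, rfl⟩ := hback y ⟨i + 1, by rw [Function.iterate_succ_apply', hy]⟩
    have hper : ∀ t, α^[k] (α^[t] x) = α^[t] x := fun t => by
      rw [← Function.iterate_add_apply, add_comm, Function.iterate_add_apply, hkx]
    obtain ⟨l, rfl⟩ : ∃ l, k = l + 1 := ⟨k - 1, by omega⟩
    rw [← hper j, ← hper i, Function.iterate_succ_apply, Function.iterate_succ_apply, hy]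

/-- If `D` restricted to a set closed under out-neighbours lives on a digraph `G` whose arcs
preserve a property that rules out cyclic orbits, then cyclic orbits avoid that set. -/
lemma not_injAlongOrbit_of_closed [DecidableEq V] {D : V → V → Prop} {m : ℕ} (f : Fin m → V)
    (hf : Function.Injective f) (G : Fin m → Fin m → Prop)
    (hclosed : ∀ i v, D (f i) v → ∃ j, v = f j ∧ G i j) (P : (Fin m → Fin m) → Prop)
    (hid : P id) (harc : ∀ β i j, G i j → P β → P (arcMap i j ∘ β))
    (hP : ∀ β, P β → ∀ x, β x = x ∨ ∃ k y, β y = β (β^[k] x) ∧ y ≠ β^[k] x)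
    (w : List (V × V)) (hw : ∀ e ∈ w, D e.1 e.2) (i : Fin m) (hi : wordEval w (f i) ≠ f i) :
    ¬ InjAlongOrbit (wordEval w) (f i) := by
  have key : ∃ β, P β ∧ ∀ i, wordEval w (f i) = f (β i) := by
    clear hi
    induction w using List.reverseRecOn with
    | nil => exact ⟨id, hid, fun _ => rfl⟩
    | append_singleton u e ih =>
      obtain ⟨β, hβ, hu⟩ := ih fun e he => hw e (by simp [he])
      by_cases he : ∃ j, e.1 = f j
      · obtain ⟨j, hj⟩ := he
        obtain ⟨l, hl, hG⟩ := hclosed j e.2 (hj ▸ hw e (by simp))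
        refine ⟨arcMap j l ∘ β, harc β j l hG hβ, fun i => ?_⟩
        rw [wordEval_concat, hu, hj, hl]
        simp only [arcMap, Function.comp_apply, hf.eq_iff]
        split_ifs <;> rfl
      · push Not at he
        refine ⟨β, hβ, fun i => ?_⟩
        rw [wordEval_concat, hu, arcMap, if_neg (he _).symm]
  obtain ⟨β, hβ, hwβ⟩ := key
  have hiter : ∀ k, (wordEval w)^[k] (f i) = f (β^[k] i) := by
    intro k
    induction k with
    | zero => rfl
    | succ k ih => rw [Function.iterate_succ_apply', Function.iterate_succ_apply', ih, hwβ]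
  intro hinj
  rcases hP β hβ i with h | ⟨k, y, hy, hne⟩
  · exact hi (by rw [hwβ, h])
  · refine hne (hf ?_)
    rw [← hiter]
    apply hinj
    rw [hiter, hwβ, hwβ, hy]

end ClosedSets

section SmallDigraphs

lemma exists_not_injective_fibre_of_not_injective :
    ∀ β : Fin 3 → Fin 3, (β = id ∨ ¬ Function.Injective β) →
      ∀ x, β x = x ∨ ∃ k y, β y = β (β^[k] x) ∧ y ≠ β^[k] x := by
  suffices h : ∀ β : Fin 3 → Fin 3, (β = id ∨ ∃ i j, β i = β j ∧ i ≠ j) →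
      ∀ x, β x = x ∨ ∃ k : Fin 4, ∃ y, β y = β (β^[k] x) ∧ y ≠ β^[k] x by
    intro β hβ x
    have hβ' : β = id ∨ ∃ i j, β i = β j ∧ i ≠ j := by
      simpa [Function.Injective] using hβ
    exact (h β hβ' x).imp_right fun ⟨k, hk⟩ => ⟨k, hk⟩
  decide

/-- The values `a, b, c, d` of a map on the bidirected star with centre `0` and leaves
`1, 2, 3`: the identity, or a map of rank at most two, or a map moving leaves at most
to the centre. -/
def StarShape (a b c d : Fin 4) : Prop :=
  (a = 0 ∧ b = 1 ∧ c = 2 ∧ d = 3) ∨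
  ((a = b ∧ (a = c ∨ a = d ∨ c = d)) ∨ (a = c ∧ (a = d ∨ b = d)) ∨ (a = d ∧ b = c) ∨
    (b = c ∧ b = d)) ∨
  ((a = b ∨ a = c ∨ a = d) ∧ (b = 0 ∨ b = 1) ∧ (c = 0 ∨ c = 2) ∧ (d = 0 ∨ d = 3))

/-- The values `a, b, c, d` of a map on the bidirected `4`-cycle `0, 1, 2, 3`: the identity, or
a noninjective map whose cyclic sequence of values has at most one descent. -/
def CycleShape (a b c d : Fin 4) : Prop :=
  (a = 0 ∧ b = 1 ∧ c = 2 ∧ d = 3) ∨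
  ((a = b ∨ a = c ∨ a = d ∨ b = c ∨ b = d ∨ c = d) ∧
    ((a ≤ b ∧ b ≤ c ∧ c ≤ d) ∨ (b ≤ c ∧ c ≤ d ∧ d ≤ a) ∨ (c ≤ d ∧ d ≤ a ∧ a ≤ b) ∨
      (d ≤ a ∧ a ≤ b ∧ b ≤ c)))

instance (a b c d : Fin 4) : Decidable (StarShape a b c d) := by
  unfold StarShape; infer_instance

instance (a b c d : Fin 4) : Decidable (CycleShape a b c d) := by
  unfold CycleShape; infer_instance

set_option maxRecDepth 100000 in
lemma starShape_arc : ∀ a b c d i j : Fin 4, (i = 0 ∧ j ≠ 0 ∨ i ≠ 0 ∧ j = 0) →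
    StarShape a b c d →
    StarShape (arcMap i j a) (arcMap i j b) (arcMap i j c) (arcMap i j d) := by
  decide

set_option maxRecDepth 100000 in
lemma cycleShape_arc : ∀ a b c d i j : Fin 4, (j = i + 1 ∨ i = j + 1) →
    CycleShape a b c d →
    CycleShape (arcMap i j a) (arcMap i j b) (arcMap i j c) (arcMap i j d) := by
  decide

set_option maxRecDepth 100000 in
lemma shape_fibre : ∀ a b c d : Fin 4, StarShape a b c d ∨ CycleShape a b c d →
    ∀ x, ![a, b, c, d] x = x ∨ ∃ k : Fin 4, ∃ y,
      ![a, b, c, d] y = ![a, b, c, d] ((![a, b, c, d])^[k] x) ∧ y ≠ (![a, b, c, d])^[k] x := by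
  decide

lemma shape_fibre_iterate (β : Fin 4 → Fin 4)
    (h : StarShape (β 0) (β 1) (β 2) (β 3) ∨ CycleShape (β 0) (β 1) (β 2) (β 3)) (x : Fin 4) :
    β x = x ∨ ∃ k y, β y = β (β^[k] x) ∧ y ≠ β^[k] x := by
  have hβ : ![β 0, β 1, β 2, β 3] = β := by
    ext i; fin_cases i <;> rfl
  have := shape_fibre _ _ _ _ h x
  rw [hβ] at this
  exact this.imp_right fun ⟨k, hk⟩ => ⟨k, hk⟩

end SmallDigraphs

section ForbiddenFreeStructure

lemma injective_vec3 {a b c : V} (hab : a ≠ b) (hac : a ≠ c) (hbc : b ≠ c) :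
    Function.Injective ![a, b, c] := by
  intro i j h
  fin_cases i <;> fin_cases j <;> simp_all

lemma injective_vec4 {a b c d : V} (hab : a ≠ b) (hac : a ≠ c) (had : a ≠ d) (hbc : b ≠ c)
    (hbd : b ≠ d) (hcd : c ≠ d) : Function.Injective ![a, b, c, d] := by
  intro i j h
  fin_cases i <;> fin_cases j <;> simp_all

lemma injective_vec5 {a b c d e : V} (hab : a ≠ b) (hac : a ≠ c) (had : a ≠ d) (hae : a ≠ e)
    (hbc : b ≠ c) (hbd : b ≠ d) (hbe : b ≠ e) (hcd : c ≠ d) (hce : c ≠ e) (hde : d ≠ e) :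
    Function.Injective ![a, b, c, d, e] := by
  intro i j h
  fin_cases i <;> fin_cases j <;> simp_all

variable {D : V → V → Prop}

lemma eq_of_triangle_exit (hfree : ForbiddenFree D) {a b c v : V} (hab : D a b) (hbc : D b c)
    (hca : D c a) (h1 : a ≠ b) (h2 : a ≠ c) (h3 : b ≠ c) (hv : D c v) (hcv : c ≠ v) :
    v = a ∨ v = b := by
  by_contra! hne
  refine hfree.2.2.1 ⟨![a, b, c, v],
    injective_vec4 h1 h2 hne.1.symm h3 hne.2.symm hcv, fun i j hij => ?_⟩
  fin_cases i <;> fin_cases j <;> simp_all [Gamma3]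

lemma eq_of_square_exit (hfree : ForbiddenFree D) {a b c d v : V} (hab : D a b) (hbc : D b c)
    (hcd : D c d) (hda : D d a) (h1 : a ≠ b) (h2 : a ≠ c) (h3 : a ≠ d) (h4 : b ≠ c) (h5 : b ≠ d)
    (h6 : c ≠ d) (hv : D d v) (hdv : d ≠ v) : v = a ∨ v = c := by
  by_cases hvb : v = b
  · subst hvb
    rcases eq_of_triangle_exit hfree hbc hcd hv h4 h5 h6 hda h3.symm with h | h
    exacts [absurd h h1, absurd h h2]
  by_contra! hne
  refine hfree.2.2.2.1 ⟨![a, b, c, d, v],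
    injective_vec5 h1 h2 h3 hne.1.symm h4 h5 (Ne.symm hvb) h6 hne.2.symm hdv, fun i j hij => ?_⟩
  fin_cases i <;> fin_cases j <;> simp_all [Gamma4]

lemma eq_of_claw_centre_exit (hfree : ForbiddenFree D) (hloop : ∀ v, ¬ D v v) {s a b c v : V}
    (hsa : D s a) (has : D a s) (hsb : D s b) (hbs : D b s) (hsc : D s c) (hcs : D c s)
    (hab : a ≠ b) (hac : a ≠ c) (hbc : b ≠ c) (hv : D s v) : v = a ∨ v = b ∨ v = c := by
  have ne : ∀ {x y}, D x y → x ≠ y := fun h e => hloop _ (e ▸ h)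
  by_contra! hne
  refine hfree.1 ⟨![a, b, c, s, v], injective_vec5 hab hac (ne has) hne.1.symm hbc (ne hbs)
    hne.2.1.symm (ne hcs) hne.2.2.symm (ne hv), fun i j hij => ?_⟩
  fin_cases i <;> fin_cases j <;> simp_all [Gamma1]

lemma eq_of_claw_leaf_exit (hfree : ForbiddenFree D) (hloop : ∀ v, ¬ D v v) {s a b c v : V}
    (hsa : D s a) (has : D a s) (hsb : D s b) (hbs : D b s) (hsc : D s c) (hcs : D c s)
    (hab : a ≠ b) (hac : a ≠ c) (hbc : b ≠ c) (hv : D c v) : v = s := by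
  have ne : ∀ {x y}, D x y → x ≠ y := fun h e => hloop _ (e ▸ h)
  have hva : v ≠ a := by
    rintro rfl
    rcases eq_of_triangle_exit hfree hv has hsc hac.symm (ne hcs) (ne has) hsb (ne hsb) with h | h
    exacts [hbc h, hab h.symm]
  have hvb : v ≠ b := by
    rintro rfl
    rcases eq_of_triangle_exit hfree hv hbs hsc hbc.symm (ne hcs) (ne hbs) hsa (ne hsa) with h | h
    exacts [hac h, hab h]
  by_contra hne
  refine hfree.2.1 ⟨![a, b, s, c, v], injective_vec5 hab (ne has) hac hva.symm (ne hbs) hbc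
    hvb.symm (ne hsc) (Ne.symm hne) (ne hv), fun i j hij => ?_⟩
  fin_cases i <;> fin_cases j <;> simp_all [Gamma2]

lemma mem_range_of_closed {m : ℕ} {f : Fin m → V} {G : Fin m → Fin m → Prop}
    (hclosed : ∀ i v, D (f i) v → ∃ j, v = f j ∧ G i j) {i : Fin m} {x : V}
    (hx : Relation.ReflTransGen D (f i) x) : ∃ j, x = f j := by
  induction hx with
  | refl => exact ⟨i, rfl⟩
  | tail _ h ih =>
    obtain ⟨j, rfl⟩ := ih
    obtain ⟨l, hl, -⟩ := hclosed j _ h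
    exact ⟨l, hl⟩

lemma not_injAlongOrbit_of_onTriangle [DecidableEq V] (hfree : ForbiddenFree D)
    (hloop : ∀ v, ¬ D v v) {s x : V} (hsx : Relation.ReflTransGen D s x) (w : List (V × V))
    (hw : ∀ e ∈ w, D e.1 e.2) (hx : wordEval w x ≠ x) (hs : OnTriangle D s) :
    ¬ InjAlongOrbit (wordEval w) x := by
  have ne : ∀ {x y}, D x y → x ≠ y := fun h e => hloop _ (e ▸ h)
  obtain ⟨a, b, hsa, hab, hbs, h1, h2, h3⟩ := hs
  have hf := injective_vec3 h1 h2 h3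
  have hclosed : ∀ i v, D (![s, a, b] i) v → ∃ j, v = ![s, a, b] j ∧ i ≠ j := by
    intro i v hv
    fin_cases i
    · rcases eq_of_triangle_exit hfree hab hbs hsa h3 h1.symm h2.symm hv (ne hv) with h | h
      exacts [⟨1, h, by decide⟩, ⟨2, h, by decide⟩]
    · rcases eq_of_triangle_exit hfree hbs hsa hab h2.symm h3.symm h1 hv (ne hv) with h | h
      exacts [⟨2, h, by decide⟩, ⟨0, h, by decide⟩]
    · rcases eq_of_triangle_exit hfree hsa hab hbs h1 h2 h3 hv (ne hv) with h | h
      exacts [⟨0, h, by decide⟩, ⟨1, h, by decide⟩]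
  obtain ⟨i, rfl⟩ := mem_range_of_closed hclosed (i := 0) hsx
  refine not_injAlongOrbit_of_closed _ hf _ hclosed (fun β => β = id ∨ ¬ Function.Injective β)
    (Or.inl rfl) ?_ exists_not_injective_fibre_of_not_injective w hw i hx
  rintro β i j hij (rfl | hβ)
  · refine Or.inr fun h => hij (h ?_)
    simp [arcMap]
  · exact Or.inr fun h => hβ h.of_comp

lemma not_injAlongOrbit_of_onSquare [DecidableEq V] (hfree : ForbiddenFree D)
    (hloop : ∀ v, ¬ D v v) {s x : V} (hsx : Relation.ReflTransGen D s x) (w : List (V × V))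
    (hw : ∀ e ∈ w, D e.1 e.2) (hx : wordEval w x ≠ x) (hs : OnSquare D s) :
    ¬ InjAlongOrbit (wordEval w) x := by
  have ne : ∀ {x y}, D x y → x ≠ y := fun h e => hloop _ (e ▸ h)
  obtain ⟨a, b, c, hsa, hab, hbc, hcs, h1, h2, h3, h4, h5, h6⟩ := hs
  have hf := injective_vec4 h1 h2 h3 h4 h5 h6
  have hclosed : ∀ i v, D (![s, a, b, c] i) v →
      ∃ j, v = ![s, a, b, c] j ∧ (j = i + 1 ∨ i = j + 1) := by
    intro i v hv
    fin_cases i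
    · rcases eq_of_square_exit hfree hab hbc hcs hsa h4 h5 h1.symm h6 h2.symm h3.symm hv (ne hv)
        with h | h
      exacts [⟨1, h, by decide⟩, ⟨3, h, by decide⟩]
    · rcases eq_of_square_exit hfree hbc hcs hsa hab h6 h2.symm h4.symm h3.symm h5.symm h1 hv
        (ne hv) with h | h
      exacts [⟨2, h, by decide⟩, ⟨0, h, by decide⟩]
    · rcases eq_of_square_exit hfree hcs hsa hab hbc h3.symm h5.symm h6.symm h1 h2 h4 hv
        (ne hv) with h | h
      exacts [⟨3, h, by decide⟩, ⟨1, h, by decide⟩]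
    · rcases eq_of_square_exit hfree hsa hab hbc hcs h1 h2 h3 h4 h5 h6 hv (ne hv) with h | h
      exacts [⟨0, h, by decide⟩, ⟨2, h, by decide⟩]
  obtain ⟨i, rfl⟩ := mem_range_of_closed hclosed (i := 0) hsx
  exact not_injAlongOrbit_of_closed _ hf _ hclosed
    (fun β => CycleShape (β 0) (β 1) (β 2) (β 3)) (by decide)
    (fun β i j hij hβ => cycleShape_arc _ _ _ _ i j hij hβ)
    (fun β hβ => shape_fibre_iterate β (Or.inr hβ)) w hw i hx

lemma not_injAlongOrbit_of_isClawCentre [DecidableEq V] (hfree : ForbiddenFree D)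
    (hloop : ∀ v, ¬ D v v) {s x : V} (hsx : Relation.ReflTransGen D s x) (w : List (V × V))
    (hw : ∀ e ∈ w, D e.1 e.2) (hx : wordEval w x ≠ x) (hs : IsClawCentre D s) :
    ¬ InjAlongOrbit (wordEval w) x := by
  have ne : ∀ {x y}, D x y → x ≠ y := fun h e => hloop _ (e ▸ h)
  obtain ⟨a, b, c, hsa, has, hsb, hbs, hsc, hcs, h1, h2, h3⟩ := hs
  have hf := injective_vec4 (ne hsa) (ne hsb) (ne hsc) h1 h2 h3
  have hclosed : ∀ i v, D (![s, a, b, c] i) v →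
      ∃ j, v = ![s, a, b, c] j ∧ (i = 0 ∧ j ≠ 0 ∨ i ≠ 0 ∧ j = 0) := by
    intro i v hv
    fin_cases i
    · rcases eq_of_claw_centre_exit hfree hloop hsa has hsb hbs hsc hcs h1 h2 h3 hv with h | h | h
      exacts [⟨1, h, by decide⟩, ⟨2, h, by decide⟩, ⟨3, h, by decide⟩]
    · exact ⟨0, eq_of_claw_leaf_exit hfree hloop hsb hbs hsc hcs hsa has h3 h1.symm h2.symm hv,
        by decide⟩
    · exact ⟨0, eq_of_claw_leaf_exit hfree hloop hsa has hsc hcs hsb hbs h2 h1 h3.symm hv,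
        by decide⟩
    · exact ⟨0, eq_of_claw_leaf_exit hfree hloop hsa has hsb hbs hsc hcs h1 h2 h3 hv, by decide⟩
  obtain ⟨i, rfl⟩ := mem_range_of_closed hclosed (i := 0) hsx
  exact not_injAlongOrbit_of_closed _ hf _ hclosed
    (fun β => StarShape (β 0) (β 1) (β 2) (β 3)) (by decide)
    (fun β i j hij hβ => starShape_arc _ _ _ _ i j hij hβ)
    (fun β hβ => shape_fibre_iterate β (Or.inl hβ)) w hw i hx

/-- In a forbidden-free digraph every directed cycle has at most four vertices. -/
lemma le_one_of_cycle (hfree : ForbiddenFree D) {k : ℕ} {q : ℕ → V}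
    (hq : Set.InjOn q (Set.Iic k)) (hD : ∀ t, t < k → D (q t) (q (t + 1))) (hclose : D (q k) (q 0))
    (htri : ¬ OnTriangle D (q 0)) (hsq : ¬ OnSquare D (q 0)) : k ≤ 1 := by
  have hne : ∀ i j, i ≤ k → j ≤ k → i ≠ j → q i ≠ q j := fun i j hi hj hij e =>
    hij (hq hi hj e)
  by_contra! hk
  obtain rfl | rfl | hk : k = 2 ∨ k = 3 ∨ 4 ≤ k := by omega
  · exact htri ⟨q 1, q 2, hD 0 (by omega), hD 1 (by omega), hclose,
      hne _ _ (by omega) (by omega) (by omega), hne _ _ (by omega) (by omega) (by omega),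
      hne _ _ (by omega) (by omega) (by omega)⟩
  · exact hsq ⟨q 1, q 2, q 3, hD 0 (by omega), hD 1 (by omega), hD 2 (by omega), hclose,
      hne _ _ (by omega) (by omega) (by omega), hne _ _ (by omega) (by omega) (by omega),
      hne _ _ (by omega) (by omega) (by omega), hne _ _ (by omega) (by omega) (by omega),
      hne _ _ (by omega) (by omega) (by omega), hne _ _ (by omega) (by omega) (by omega)⟩
  · refine hfree.2.2.2.2 (k + 1) (by omega) ⟨fun i => q i, ?_, ?_⟩
    · intro i j hij
      exact Fin.ext (hq (Nat.lt_succ_iff.1 i.2) (Nat.lt_succ_iff.1 j.2) hij)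
    · intro i j hij
      simp only [Theta] at hij
      change D (q i) (q j)
      rw [hij]
      rcases Nat.lt_succ_iff_lt_or_eq.1 i.2 with h | h
      · rw [Nat.mod_eq_of_lt (by omega)]
        exact hD _ h
      · rw [h, Nat.mod_self]
        exact hclose

lemma exists_injOn_path {u v : V} (h : Relation.ReflTransGen D u v) :
    ∃ (k : ℕ) (q : ℕ → V), q 0 = u ∧ q k = v ∧ (∀ t, t < k → D (q t) (q (t + 1))) ∧
      Set.InjOn q (Set.Iic k) := by
  classical
  have hex : ∃ k, ∃ q : ℕ → V, q 0 = u ∧ q k = v ∧ ∀ t, t < k → D (q t) (q (t + 1)) := by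
    induction h with
    | refl => exact ⟨0, fun _ => u, rfl, rfl, by simp⟩
    | @tail b c _ hbc ih =>
      obtain ⟨k, q, h0, hk, hD⟩ := ih
      refine ⟨k + 1, fun t => if t ≤ k then q t else c, by simp [h0], by simp, fun t ht => ?_⟩
      rcases Nat.lt_succ_iff_lt_or_eq.1 ht with h | rfl
      · simpa [h.le, Nat.succ_le_iff.2 h] using hD t h
      · simpa [hk] using hbc
  obtain ⟨q, h0, hk, hD⟩ := Nat.find_spec hex
  refine ⟨Nat.find hex, q, h0, hk, hD, ?_⟩
  have key : ∀ i j, i < j → j ≤ Nat.find hex → q i ≠ q j := by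
    intro i j hij hj e
    refine Nat.find_min hex (m := Nat.find hex - (j - i)) (by omega)
      ⟨fun t => if t ≤ i then q t else q (t + (j - i)), by simp [h0], ?_, fun t ht => ?_⟩
    · by_cases hjk : j = Nat.find hex
      · have h1 : Nat.find hex - (j - i) = i := by omega
        simp only [h1, le_refl, if_true]
        rw [e, hjk, hk]
      · have h1 : ¬ Nat.find hex - (j - i) ≤ i := by omega
        have h2 : Nat.find hex - (j - i) + (j - i) = Nat.find hex := by omega
        simp only [h1, if_false, h2, hk]
    · rcases lt_trichotomy t i with h | rfl | h
      · simpa [h.le, Nat.succ_le_iff.2 h] using hD t (by omega)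
      · have h1 : t + 1 + (j - t) = j + 1 := by omega
        simpa [h1, e] using hD j (by omega)
      · have h1 : ¬ t ≤ i := by omega
        have h2 : ¬ t + 1 ≤ i := by omega
        have h3 : t + 1 + (j - i) = t + (j - i) + 1 := by omega
        simpa only [h1, h2, if_false, h3] using hD (t + (j - i)) (by omega)
  intro i hi j hj e
  rcases lt_trichotomy i j with h | h | h
  · exact absurd e (key i j h hj)
  · exact h
  · exact absurd e.symm (key j i h hi)

lemma symm_of_reflTransGen (hfree : ForbiddenFree D) (hloop : ∀ v, ¬ D v v) {u v : V} (huv : D u v)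
    (hvu : Relation.ReflTransGen D v u) (htri : ¬ OnTriangle D v) (hsq : ¬ OnSquare D v) :
    D v u := by
  obtain ⟨k, q, rfl, rfl, hD, hinj⟩ := exists_injOn_path hvu
  have hk := le_one_of_cycle hfree hinj hD huv htri hsq
  interval_cases k
  · exact absurd huv (hloop _)
  · exact hD 0 (by omega)

/-- A strong component of a forbidden-free digraph without triangles, squares and claws is a
bidirected path, hence has a position function. -/
lemma exists_position [Finite V] (hfree : ForbiddenFree D) (hloop : ∀ v, ¬ D v v) (x : V)
    (S : Set V) (hS : S = {v | Relation.ReflTransGen D x v ∧ Relation.ReflTransGen D v x})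
    (htri : ∀ v ∈ S, ¬ OnTriangle D v) (hsq : ∀ v ∈ S, ¬ OnSquare D v)
    (hclaw : ∀ v ∈ S, ¬ IsClawCentre D v) :
    ∃ h : V → ℤ, Set.InjOn h S ∧ ∀ u ∈ S, ∀ v ∈ S, D u v → |h u - h v| ≤ 1 := by
  have hxS : x ∈ S := hS ▸ ⟨.refl, .refl⟩
  have hconn : ∀ u ∈ S, ∀ v ∈ S, Relation.ReflTransGen D u v := by
    rw [hS]
    exact fun u hu v hv => hu.2.trans hv.1
  have hsymm : ∀ u ∈ S, ∀ v ∈ S, D u v → D v u := fun u hu v hv huv =>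
    symm_of_reflTransGen hfree hloop huv (hconn v hv u hu) (htri v hv) (hsq v hv)
  let P : ℕ → (ℕ → V) → Prop := fun m p => Set.InjOn p (Set.Iic m) ∧ (∀ i ≤ m, p i ∈ S) ∧
    ∀ i < m, D (p i) (p (i + 1))
  obtain ⟨m, ⟨p, hp⟩, hmax⟩ : ∃ m, (∃ p, P m p) ∧ ¬ ∃ p, P (m + 1) p := by
    by_contra! hstep
    have hall : ∀ m, ∃ p, P m p := by
      intro m
      induction m with
      | zero =>
        refine ⟨fun _ => x, ?_, fun _ _ => hxS, by simp⟩
        intro i hi j hj _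
        simp only [Set.mem_Iic] at hi hj
        omega
      | succ m ih => exact hstep m ih
    obtain ⟨p, hinj, -⟩ := hall (Nat.card V)
    have h1 := hinj.ncard_image
    have h2 := Set.ncard_le_card (p '' Set.Iic (Nat.card V))
    rw [h1, ← Finset.coe_Iic, Set.ncard_coe_finset, Nat.card_Iic] at h2
    omega
  obtain ⟨hinj, hpS, hpD⟩ := hp
  have hpD' : ∀ i < m, D (p (i + 1)) (p i) := fun i hi =>
    hsymm _ (hpS i (by omega)) _ (hpS (i + 1) (by omega)) (hpD i hi)
  have hchord : ∀ i j, i < j → j ≤ m → D (p j) (p i) → j = i + 1 := by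
    intro i j hij hj hD
    have := le_one_of_cycle (D := D) hfree (k := j - i) (q := fun t => p (i + t)) ?_ ?_ ?_
      (htri _ (hpS _ (by omega))) (hsq _ (hpS _ (by omega)))
    · omega
    · intro s hs t ht e
      simp only [Set.mem_Iic] at hs ht
      have := hinj (by simp; omega) (by simp; omega) e
      omega
    · exact fun t ht => hpD (i + t) (by omega)
    · have : i + (j - i) = j := by omega
      simpa [this] using hD
  have hnbr : ∀ i ≤ m, ∀ v ∈ S, D (p i) v → ∃ j ≤ m, v = p j ∧ (j = i + 1 ∨ i = j + 1) := by
    intro i hi v hv hD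
    have hD' := hsymm _ (hpS i hi) _ hv hD
    by_cases hmem : ∃ j ≤ m, v = p j
    · obtain ⟨j, hj, rfl⟩ := hmem
      refine ⟨j, hj, rfl, ?_⟩
      rcases lt_trichotomy i j with h | rfl | h
      · exact Or.inl (hchord i j h hj hD')
      · exact absurd hD (hloop _)
      · exact Or.inr (hchord j i h hi hD)
    · push Not at hmem
      exfalso
      rcases Nat.eq_zero_or_pos i with rfl | hi0
      · refine hmax ⟨fun t => if t = 0 then v else p (t - 1), ?_, ?_, ?_⟩
        · intro s hs t ht e
          simp only [Set.mem_Iic] at hs ht e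
          split_ifs at e with h1 h2 h2
          · omega
          · exact absurd e (hmem _ (by omega))
          · exact absurd e.symm (hmem _ (by omega))
          · have := hinj (by simp; omega) (by simp; omega) e
            omega
        · intro t ht
          dsimp only
          split_ifs
          · exact hv
          · exact hpS _ (by omega)
        · intro t ht
          rcases Nat.eq_zero_or_pos t with rfl | ht0
          · simpa using hD'
          · have h1 : t - 1 + 1 = t := by omega
            have := hpD (t - 1) (by omega)
            rw [h1] at this
            simpa [ht0.ne'] using this
      rcases Nat.lt_or_ge i m with him | him
      · obtain ⟨l, rfl⟩ : ∃ l, i = l + 1 := ⟨i - 1, by omega⟩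
        refine hclaw _ (hpS _ hi) ⟨p l, p (l + 1 + 1), v, hpD' l (by omega), hpD l (by omega),
          hpD _ him, hpD' _ him, hD, hD', fun e => ?_, (hmem l (by omega)).symm,
          (hmem _ (by omega)).symm⟩
        have := hinj (by simp; omega) (by simp; omega) e
        omega
      · obtain rfl : i = m := by omega
        refine hmax ⟨fun t => if t ≤ i then p t else v, ?_, ?_, ?_⟩
        · intro s hs t ht e
          simp only [Set.mem_Iic] at hs ht e
          split_ifs at e with h1 h2 h2
          · exact hinj h1 h2 e
          · exact absurd e.symm (hmem _ (by omega))
          · exact absurd e (hmem _ (by omega))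
          · omega
        · intro t ht
          dsimp only
          split_ifs with h
          · exact hpS _ h
          · exact hv
        · intro t ht
          rcases Nat.lt_succ_iff_lt_or_eq.1 ht with h | rfl
          · simpa [h.le, Nat.succ_le_iff.2 h] using hpD t h
          · simpa using hD
  have hcover : ∀ v, Relation.ReflTransGen D (p 0) v → v ∈ S → ∃ j ≤ m, v = p j := by
    intro v hv
    induction hv with
    | refl => exact fun _ => ⟨0, by omega, rfl⟩
    | @tail b c hb hbc ih =>
      intro hc
      have hbS : b ∈ S := by
        have h0 := hpS 0 (by omega)
        have hcx := hconn c hc x hxS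
        have hx0 := hconn x hxS _ h0
        rw [hS]
        exact ⟨hx0.trans hb, .head hbc hcx⟩
      obtain ⟨i, hi, rfl⟩ := ih hbS
      obtain ⟨j, hj, rfl, -⟩ := hnbr i hi c hc hbc
      exact ⟨j, hj, rfl⟩
  have hcover' : ∀ v ∈ S, ∃ j ≤ m, v = p j := fun v hv =>
    hcover v (hconn _ (hpS 0 (by omega)) v hv) hv
  choose! idx hidx hidx' using hcover'
  refine ⟨fun v => idx v, ?_, ?_⟩
  · intro u hu v hv e
    rw [hidx' u hu, hidx' v hv, Nat.cast_injective e]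
  · intro u hu v hv huv
    rw [hidx' u hu] at huv
    obtain ⟨j, hj, hvj, hij⟩ := hnbr _ (hidx u hu) v hv huv
    have : idx v = j := hinj (hidx v hv) hj (by rw [← hidx' v hv, hvj])
    simp only [abs_le]
    omega

end ForbiddenFreeStructure

section Ordered

variable [DecidableEq V] {D : V → V → Prop}

/-- If the strong component of a periodic point admits a position function, then tokens that are
never merged keep their order, so the point is fixed. -/
lemma fixed_of_position {x : V} (S : Set V)
    (hS : S = {v | Relation.ReflTransGen D x v ∧ Relation.ReflTransGen D v x}) (h : V → ℤ)
    (hinj : Set.InjOn h S) (hadj : ∀ u ∈ S, ∀ v ∈ S, D u v → |h u - h v| ≤ 1)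
    (w : List (V × V)) (hw : ∀ e ∈ w, D e.1 e.2) {k : ℕ} (hk : 0 < k)
    (hkx : (wordEval w)^[k] x = x) (hclean : InjAlongOrbit (wordEval w) x) :
    wordEval w x = x := by
  have hreach : ∀ i y, Relation.ReflTransGen D y ((wordEval w)^[i] y) := by
    intro i y
    induction i with
    | zero => exact .refl
    | succ i ih =>
      rw [Function.iterate_succ_apply']
      exact ih.trans (reflTransGen_wordEval w hw _)
  have hback : ∀ i, Relation.ReflTransGen D ((wordEval w)^[i] x) x := by
    intro i
    have h1 : (wordEval w)^[i * k] x = x := by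
      rw [mul_comm, Function.iterate_mul, Function.iterate_fixed hkx]
    have h2 := hreach (i * k - i) ((wordEval w)^[i] x)
    rwa [← Function.iterate_add_apply, Nat.sub_add_cancel (Nat.le_mul_of_pos_right i hk), h1]
      at h2
  have hS' : ∀ u v, w = u ++ v → ∀ i, wordEval u ((wordEval w)^[i] x) ∈ S := by
    intro u v huv i
    rw [hS]
    refine ⟨(hreach i x).trans (reflTransGen_wordEval u (fun e he => hw e ?_) _),
      .trans ?_ (hback (i + 1))⟩
    · simp [huv, he]
    · have := reflTransGen_wordEval (D := D) v (fun e he => hw e (by simp [huv, he]))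
        (wordEval u ((wordEval w)^[i] x))
      rwa [← wordEval_append, ← huv, ← Function.iterate_succ_apply' (wordEval w)] at this
  have horder : ∀ u v, w = u ++ v → ∀ i j, h ((wordEval w)^[i] x) < h ((wordEval w)^[j] x) →
      h (wordEval u ((wordEval w)^[i] x)) < h (wordEval u ((wordEval w)^[j] x)) := by
    intro u
    induction u using List.reverseRecOn with
    | nil => exact fun _ _ _ _ hlt => hlt
    | append_singleton u e ih =>
      intro v huv i j hlt
      have huv' : w = u ++ (e :: v) := by simp [huv]
      have hlt' := ih _ huv' i j hlt
      have hne : h (wordEval (u ++ [e]) ((wordEval w)^[i] x)) ≠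
          h (wordEval (u ++ [e]) ((wordEval w)^[j] x)) := by
        intro heq
        have h1 := hinj (hS' _ v huv i) (hS' _ v huv j) heq
        have h2 := congrArg (wordEval v) h1
        rw [← wordEval_append, ← wordEval_append, ← huv] at h2
        rw [hclean j _ h2] at hlt
        exact lt_irrefl _ hlt
      have hi := hS' _ v huv i
      have hj := hS' _ v huv j
      have hi' := hS' _ _ huv' i
      have hj' := hS' _ _ huv' j
      have he := hw e (by simp [huv])
      rw [wordEval_concat] at hi hj hne ⊢
      rw [wordEval_concat] at hne ⊢
      generalize wordEval u ((wordEval w)^[i] x) = y at *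
      generalize wordEval u ((wordEval w)^[j] x) = z at *
      unfold arcMap at *
      split_ifs at * with h1 h2 h2
      · exact absurd rfl hne
      · subst h1
        have := abs_le.1 (hadj _ hi' _ hi he)
        omega
      · subst h2
        have := abs_le.1 (hadj _ hj' _ hj he)
        omega
      · exact hlt'
  have hmono : ∀ i j, h ((wordEval w)^[i] x) < h ((wordEval w)^[j] x) →
      h ((wordEval w)^[i + 1] x) < h ((wordEval w)^[j + 1] x) := by
    intro i j hlt
    simpa only [Function.iterate_succ_apply'] using horder w [] (by simp) i j hlt
  by_contra hx
  have hxS : ∀ i, (wordEval w)^[i] x ∈ S := hS' [] w rfl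
  rcases lt_trichotomy (h x) (h (wordEval w x)) with hlt | heq | hlt
  · have hstep : ∀ i, h ((wordEval w)^[i] x) < h ((wordEval w)^[i + 1] x) := fun i => by
      induction i with
      | zero => exact hlt
      | succ i ih => exact hmono _ _ ih
    have := strictMono_nat_of_lt_succ (f := fun i => h ((wordEval w)^[i] x)) hstep hk
    simp [hkx] at this
  · exact hx (hinj (hxS 1) (hxS 0) heq.symm)
  · have hstep : ∀ i, h ((wordEval w)^[i + 1] x) < h ((wordEval w)^[i] x) := fun i => by
      induction i with
      | zero => exact hlt
      | succ i ih => exact hmono _ _ ih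
    have := strictAnti_nat_of_succ_lt (f := fun i => h ((wordEval w)^[i] x)) hstep hk
    simp [hkx] at this

end Ordered

lemma cyclCnt_eq_zero_of_forbiddenFree [Finite V] [DecidableEq V] {D : V → V → Prop}
    (hfree : ForbiddenFree D) (hloop : ∀ v, ¬ D v v) {α : V → V} (hα : InGen D α) :
    cyclCnt α = 0 := by
  obtain ⟨w, -, hw, rfl⟩ := hα
  rw [cyclCnt, Set.ncard_eq_zero (Set.toFinite _), Set.eq_empty_iff_forall_notMem]
  intro C hC
  obtain ⟨x, k, hk, hkx, hx, hclean⟩ := exists_injAlongOrbit_of_isCyclicOrbit hC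
  obtain ⟨h, hinj, hadj⟩ := exists_position hfree hloop x _ rfl
    (fun v hv hv' => not_injAlongOrbit_of_onTriangle hfree hloop hv.2 w hw hx hv' hclean)
    (fun v hv hv' => not_injAlongOrbit_of_onSquare hfree hloop hv.2 w hw hx hv' hclean)
    (fun v hv hv' => not_injAlongOrbit_of_isClawCentre hfree hloop hv.2 w hw hx hv' hclean)
  exact hx (fixed_of_position _ rfl h hinj hadj w hw hk hkx hclean)

/-- for a connected simple digraph `D` on `{1,…,n}`, `n ≥ 2`, every
`α ∈ ⟨D⟩` has `cycl(α) = 0` iff `D` has no subdigraph isomorphic to `Γ1`, `Γ2`, `Γ3`,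
`Γ4`, or `Θ_k` for any `k ≥ 5`. -/
theorem stmt8 (n : ℕ) (hn : 2 ≤ n) (D : Fin n → Fin n → Prop) (hloop : ∀ v, ¬ D v v)
    (hconn : ConnectedDigraph D) :
    (∀ α : Fin n → Fin n, InGen D α → cyclCnt α = 0) ↔ ForbiddenFree D := by
  constructor
  · intro h
    have key : ¬ ∃ α, InGen D α ∧ cyclCnt α ≠ 0 := fun ⟨α, hα, hne⟩ => hne (h α hα)
    exact ⟨fun hH => key (exists_inGen_of_gamma1 hH), fun hH => key (exists_inGen_of_gamma2 hH),
      fun hH => key (exists_inGen_of_gamma3 hH), fun hH => key (exists_inGen_of_gamma4 hH),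
      fun _ hk hH => key (exists_inGen_of_theta hk hH)⟩
  · exact fun hfree α hα => cyclCnt_eq_zero_of_forbiddenFree hfree hloop hα
end
end

section
/- Let D be a connected simple digraph on {1,…,n} with n ≥ 3. Then ℓ(D, α) = n − fix(α) for all α ∈ ⟨D⟩ if and only if D is closed and satisfies properties (★) and (★★). -/
noncomputable section

variable {V : Type*}

namespace ArcWords

open Relation

section Words

variable [DecidableEq V]

@[simp] lemma wordEval_nil (x : V) : wordEval ([] : List (V × V)) x = x := rfl

@[simp] lemma wordEval_cons (e : V × V) (w : List (V × V)) (x : V) :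
    wordEval (e :: w) x = wordEval w (arcMap e.1 e.2 x) := rfl

lemma wordEval_append (w₁ w₂ : List (V × V)) (x : V) :
    wordEval (w₁ ++ w₂) x = wordEval w₂ (wordEval w₁ x) := by
  simp [wordEval, List.foldl_append]

/-- A property of maps which holds for the identity and is stable under composition with
arcs of `D` holds for all words in the arcs of `D`. -/
lemma wordEval_induction {D : V → V → Prop} (P : (V → V) → Prop) (hid : P id)
    (hstep : ∀ f a b, D a b → P f → P (fun x => arcMap a b (f x))) (w : List (V × V))
    (hw : ∀ e ∈ w, D e.1 e.2) : P (wordEval w) := by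
  induction w using List.reverseRecOn with
  | nil => exact hid
  | append_singleton w e ih =>
    have h := hstep _ e.1 e.2 (hw e (by simp)) (ih fun e' he' => hw e' (by simp [he']))
    convert h using 1
    funext x
    rw [wordEval_append]
    rfl

lemma wordEval_of_notMem (w : List (V × V)) (x : V) (hx : x ∉ w.map Prod.fst) :
    wordEval w x = x := by
  induction w with
  | nil => rfl
  | cons e w ih =>
    simp only [List.map_cons, List.mem_cons, not_or] at hx
    rw [wordEval_cons, arcMap, if_neg hx.1, ih hx.2]

lemma reflTransGen_wordEval {D : V → V → Prop} (w : List (V × V))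
    (hw : ∀ e ∈ w, D e.1 e.2) (x : V) : ReflTransGen D x (wordEval w x) := by
  refine wordEval_induction (D := D) (fun f => ReflTransGen D x (f x)) .refl ?_ w hw
  intro f a b hab h
  simp only [arcMap]
  split_ifs with hfa
  · exact h.tail (hfa ▸ hab)
  · exact h

/-- The points moved by a map. -/
def moved [Fintype V] (α : V → V) : Finset V := Finset.univ.filter fun x => α x ≠ x

@[simp] lemma mem_moved [Fintype V] {α : V → V} {x : V} : x ∈ moved α ↔ α x ≠ x := by
  simp [moved]

lemma card_moved [Fintype V] (α : V → V) : (moved α).card = Fintype.card V - fixCnt α := by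
  have h : fixCnt α = (Finset.univ.filter fun x => α x = x).card := by
    rw [fixCnt, ← Set.ncard_coe_finset]
    simp
  have := Finset.card_filter_add_card_filter_not (s := (Finset.univ : Finset V))
    (fun x => α x = x)
  rw [Finset.card_univ] at this
  rw [h, moved]
  simp only [ne_eq]
  omega

lemma moved_subset_sources [Fintype V] (w : List (V × V)) :
    moved (wordEval w) ⊆ (w.map Prod.fst).toFinset := by
  intro x hx
  by_contra h
  exact mem_moved.1 hx (wordEval_of_notMem w x (by simpa using h))

lemma card_moved_le_length [Fintype V] (w : List (V × V)) :
    (moved (wordEval w)).card ≤ w.length := by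
  simpa using (Finset.card_le_card (moved_subset_sources w)).trans
    (List.toFinset_card_le (w.map Prod.fst))

lemma arcLen_eq [Fintype V] {D : V → V → Prop} (w : List (V × V))
    (hw : ∀ e ∈ w, D e.1 e.2) (hlen : w.length = (moved (wordEval w)).card) :
    arcLen D (wordEval w) = Fintype.card V - fixCnt (wordEval w) := by
  rw [← card_moved]
  apply le_antisymm
  · exact Nat.sInf_le ⟨w, hlen, hw, rfl⟩
  · refine le_csInf ⟨_, w, rfl, hw, rfl⟩ ?_
    rintro k ⟨w', rfl, -, h⟩
    rw [← h]
    exact card_moved_le_length w'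

/-- In a word whose sources are distinct, each source `v` is carried along an arc `(v→x)`
either directly to its final place, which has been vacated before, or together with `x`. -/
lemma exists_arc_of_nodup (w : List (V × V)) (hnd : (w.map Prod.fst).Nodup) (v : V)
    (hv : v ∈ w.map Prod.fst) :
    ∃ x, (v, x) ∈ w ∧ (wordEval w x = wordEval w v ∨
      (wordEval w v = x ∧ (w.map Prod.fst).idxOf x < (w.map Prod.fst).idxOf v)) := by
  obtain ⟨⟨v', x⟩, hmem, rfl⟩ := List.mem_map.1 hv
  obtain ⟨w₁, w₂, rfl⟩ := List.append_of_mem hmem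
  simp only [List.map_append, List.map_cons] at hnd ⊢
  rw [List.nodup_append] at hnd
  obtain ⟨h₁, h₂, h₃⟩ := hnd
  have hv₁ : v' ∉ w₁.map Prod.fst := fun h => h₃ _ h v' (by simp) rfl
  have hev : wordEval (w₁ ++ (v', x) :: w₂) v' = wordEval w₂ x := by
    rw [wordEval_append, wordEval_of_notMem w₁ v' hv₁]
    simp [arcMap]
  refine ⟨x, by simp, ?_⟩
  by_cases hx : x ∈ w₁.map Prod.fst
  · right
    constructor
    · rw [hev]
      exact wordEval_of_notMem _ _ fun h => h₃ _ hx x (by simp [h]) rfl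
    · rw [List.idxOf_append_of_mem hx, List.idxOf_append_of_notMem hv₁]
      have := List.idxOf_lt_length_of_mem hx
      simp only [List.idxOf_cons_self]
      omega
  · left
    rw [hev, wordEval_append, wordEval_of_notMem w₁ x hx]
    simp [arcMap]

end Words

section Necessity

variable [DecidableEq V] [Fintype V] {D : V → V → Prop}

/-- Every element of `⟨D⟩` has a word of length equal to the number of moved points. -/
def IsTight (D : V → V → Prop) : Prop :=
  ∀ α : V → V, InGen D α → arcLen D α = Fintype.card V - fixCnt α

lemma IsTight.exists_arc (h : IsTight D) (w : List (V × V)) (hne : w ≠ [])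
    (hw : ∀ e ∈ w, D e.1 e.2) :
    ∃ pos : V → ℕ, ∀ v, wordEval w v ≠ v → ∃ x, D v x ∧
      (wordEval w x = wordEval w v ∨ (wordEval w v = x ∧ pos x < pos v)) := by
  have hlen := h _ ⟨w, hne, hw, rfl⟩
  have hmem : arcLen D (wordEval w) ∈ {k | ∃ w' : List (V × V), w'.length = k ∧
      (∀ e ∈ w', D e.1 e.2) ∧ wordEval w' = wordEval w} := Nat.sInf_mem ⟨_, w, rfl, hw, rfl⟩
  obtain ⟨w', hl, hw', heq⟩ := hmem
  rw [hlen, ← card_moved, ← heq] at hl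
  rw [← heq]
  have hsub := moved_subset_sources w'
  have hnd : (w'.map Prod.fst).Nodup := by
    rw [← Multiset.coe_nodup, ← Multiset.toFinset_card_eq_card_iff_nodup]
    apply le_antisymm (Multiset.toFinset_card_le _)
    have := Finset.card_le_card hsub
    simpa [← hl] using this
  refine ⟨fun x => (w'.map Prod.fst).idxOf x, fun v hv => ?_⟩
  obtain ⟨x, hx, hx'⟩ := exists_arc_of_nodup w' hnd v
    (List.mem_toFinset.1 (hsub (mem_moved.2 hv)))
  exact ⟨x, hw' _ hx, hx'⟩

lemma IsTight.starCond (h : IsTight D) (hloop : ∀ v, ¬ D v v) : StarCond D := by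
  intro v0 v1 v2 h01 h12 h02 hn u hu
  by_contra! hne
  obtain ⟨hu0, hu1, hu2⟩ := hne
  have n01 : v0 ≠ v1 := fun e => hloop v1 (e ▸ h01)
  have n12 : v1 ≠ v2 := fun e => hloop v2 (e ▸ h12)
  rcases hu with hu | hu
  · obtain ⟨pos, hpos⟩ := h.exists_arc [(v1, u), (v0, v1), (v1, v2)] (by simp)
      (by simp [hu, h01, h12])
    obtain ⟨x, hx, hx'⟩ := hpos v0 (by simp [arcMap]; grind)
    simp only [wordEval_cons, wordEval_nil, arcMap] at hx'
    grind
  · obtain ⟨pos, hpos⟩ := h.exists_arc [(v1, v2), (v2, u), (v0, v1), (v1, v2)] (by simp)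
      (by simp [hu, h01, h12])
    obtain ⟨x, hx, hx'⟩ := hpos v0 (by simp [arcMap]; grind)
    simp only [wordEval_cons, wordEval_nil, arcMap] at hx'
    grind

lemma IsTight.no_triangle_exit (h : IsTight D) (hloop : ∀ v, ¬ D v v) {a b c d : V}
    (hac : D a c) (hba : D b a) (hcb : D c b) (hcd : D c d) (hda : d ≠ a) (hdb : d ≠ b) :
    False := by
  have n1 : a ≠ c := fun e => hloop c (e ▸ hac)
  have n2 : b ≠ a := fun e => hloop a (e ▸ hba)
  have n3 : c ≠ b := fun e => hloop b (e ▸ hcb)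
  have n4 : c ≠ d := fun e => hloop d (e ▸ hcd)
  obtain ⟨pos, hpos⟩ := h.exists_arc [(c, d), (a, c), (b, a), (c, b)] (by simp)
    (by simp [hac, hba, hcb, hcd])
  obtain ⟨x, hx, hx'⟩ := hpos a (by simp [arcMap]; grind)
  obtain ⟨y, hy, hy'⟩ := hpos b (by simp [arcMap]; grind)
  simp only [wordEval_cons, wordEval_nil, arcMap] at hx' hy'
  have := hloop a
  have := hloop b
  grind

end Necessity

section Structure

variable {D : V → V → Prop}

/-- Under (★), a vertex reachable from another is at directed distance at most two. -/
lemma exists_middle (hloop : ∀ v, ¬ D v v) (hs : StarCond D) {v t : V}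
    (h : ReflTransGen D v t) (hne : v ≠ t) (hn : ¬ D v t) : ∃ m, D v m ∧ D m t := by
  induction h using ReflTransGen.head_induction_on with
  | refl => exact absurd rfl hne
  | @head v y hvy _ ih =>
    by_cases hyt : y = t
    · exact absurd (hyt ▸ hvy) hn
    by_cases hyt' : D y t
    · exact ⟨y, hvy, hyt'⟩
    obtain ⟨m, hym, hmt⟩ := ih hyt hyt'
    by_cases hvm : D v m
    · exact ⟨m, hvm, hmt⟩
    have hne' : v ≠ m := fun e => hn (e ▸ hmt)
    rcases hs v y m hvy hym hne' hvm t (Or.inr hmt) with e | e | e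
    · exact absurd e.symm hne
    · exact absurd e.symm hyt
    · exact absurd (e ▸ hmt) (hloop _)

/-- A strong component with three distinct vertices is exhausted by them and is terminal. -/
def TriplesClosed (D : V → V → Prop) : Prop :=
  ∀ a b c d : V, a ≠ b → b ≠ c → a ≠ c → ReflTransGen D a b → ReflTransGen D b c →
    ReflTransGen D c a → ReflTransGen D c d → d = a ∨ d = b ∨ d = c

lemma triplesClosed_of_step
    (h : ∀ a b c d : V, a ≠ b → b ≠ c → a ≠ c → ReflTransGen D a b → ReflTransGen D b c →
      ReflTransGen D c a → D c d → d = a ∨ d = b ∨ d = c) : TriplesClosed D := by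
  intro a b c d hab hbc hac rab rbc rca hcd
  induction hcd with
  | refl => simp
  | @tail y z _ hyz ih =>
    rcases ih with rfl | rfl | rfl
    · have := h b c y z hbc hac.symm hab.symm rbc rca rab hyz
      tauto
    · have := h c a y z hac.symm hab hbc.symm rca rab rbc hyz
      tauto
    · exact h a b y z hab hbc hac rab rbc rca hyz

lemma TriplesClosed.starStarCond [Finite V] (h : TriplesClosed D) : StarStarCond D := by
  rintro C ⟨v, rfl⟩
  set C : Set V := {u | ReflTransGen D u v ∧ ReflTransGen D v u} with hC
  have key : 2 < C.ncard → ∃ a ∈ C, ∃ b ∈ C, ∃ c ∈ C, ∀ d, ReflTransGen D v d →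
      d = a ∨ d = b ∨ d = c := by
    intro hcard
    obtain ⟨a, ha, b, hb, c, hc, hab, hac, hbc⟩ := (Set.two_lt_ncard (Set.toFinite C)).1 hcard
    exact ⟨a, ha, b, hb, c, hc, fun d hd => h a b c d hab hbc hac (ha.1.trans hb.2)
      (hb.1.trans hc.2) (hc.1.trans ha.2) (hc.1.trans hd)⟩
  constructor
  · intro _
    by_contra! hcard
    obtain ⟨a, -, b, -, c, -, habc⟩ := key (by omega)
    have hsub : C ⊆ {a, b, c} := fun d hd => by simpa using habc d hd.2
    have h1 := Set.ncard_le_ncard hsub (Set.toFinite _)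
    have h2 : ({a, b, c} : Set V).ncard ≤ 3 := by
      refine (Set.ncard_insert_le _ _).trans ?_
      have := Set.ncard_insert_le b {c}
      rw [Set.ncard_singleton] at this
      omega
    omega
  · intro hnt
    by_contra! hcard
    obtain ⟨a, ha, b, hb, c, hc, habc⟩ := key hcard
    refine hnt ⟨⟨v, rfl⟩, ?_⟩
    rintro C' ⟨v', rfl⟩ hne ⟨x, hx, y, hy, hxy⟩
    have hyC : y ∈ C := by
      rcases habc y (hx.2.tail hxy) with rfl | rfl | rfl <;> assumption
    apply hne
    ext u
    constructor
    · rintro ⟨h1, h2⟩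
      exact ⟨h1.trans (hy.2.trans hyC.1), hyC.2.trans (hy.1.trans h2)⟩
    · rintro ⟨h1, h2⟩
      exact ⟨h1.trans (hyC.2.trans hy.1), hy.2.trans (hyC.1.trans h2)⟩

lemma triplesClosed_of_starStarCond [Finite V] (h : StarStarCond D) : TriplesClosed D := by
  intro a b c d hab hbc hac rab rbc rca hcd
  set C : Set V := {u | ReflTransGen D u c ∧ ReflTransGen D c u} with hC
  have hsc : IsSC D C := ⟨c, rfl⟩
  have hsub : ({a, b, c} : Set V) ⊆ C := by
    rintro x (rfl | rfl | rfl)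
    · exact ⟨rab.trans rbc, rca⟩
    · exact ⟨rbc, rca.trans rab⟩
    · exact ⟨.refl, .refl⟩
  have hcard : ({a, b, c} : Set V).ncard = 3 := Set.ncard_eq_three.2 ⟨a, b, c, hab, hac, hbc, rfl⟩
  have hle := Set.ncard_le_ncard hsub (Set.toFinite _)
  have hterm : IsTerminalSC D C := by
    by_contra hnt
    have := (h C hsc).2 hnt
    omega
  have heq : ({a, b, c} : Set V) = C := by
    apply Set.eq_of_subset_of_ncard_le hsub _ (Set.toFinite _)
    rw [hcard]
    exact (h C hsc).1 hterm
  have hd : d ∈ C := by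
    induction hcd with
    | refl => exact ⟨.refl, .refl⟩
    | @tail y z _ hyz ih =>
      by_contra hz
      refine hterm.2 {u | ReflTransGen D u z ∧ ReflTransGen D z u} ⟨z, rfl⟩ ?_
        ⟨y, ih, z, ⟨.refl, .refl⟩, hyz⟩
      intro e
      exact hz (e ▸ ⟨.refl, .refl⟩)
  rw [← heq] at hd
  simpa using hd

end Structure

section Necessity

variable [DecidableEq V] [Fintype V] {D : V → V → Prop}

lemma IsTight.closedDigraph (h : IsTight D) (hloop : ∀ v, ¬ D v v) : ClosedDigraph D := by
  intro a b hba hab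
  by_contra hn
  have hne : a ≠ b := fun e => hloop a (by rw [← e] at hba; exact hba)
  obtain ⟨c, hac, hcb⟩ := exists_middle hloop (h.starCond hloop) hab hne hn
  have n1 : a ≠ c := fun e => hloop c (e ▸ hac)
  have n2 : c ≠ b := fun e => hloop b (e ▸ hcb)
  obtain ⟨pos, hpos⟩ := h.exists_arc [(b, a), (c, b), (a, c), (b, a), (c, b), (a, c)] (by simp)
    (by simp [hac, hba, hcb])
  obtain ⟨x, hx, hx'⟩ := hpos a (by simp [arcMap]; grind)
  simp only [wordEval_cons, wordEval_nil, arcMap] at hx'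
  have := hloop a
  grind

lemma IsTight.triplesClosed (h : IsTight D) (hloop : ∀ v, ¬ D v v) : TriplesClosed D := by
  have hs := h.starCond hloop
  have hc := h.closedDigraph hloop
  have adj : ∀ p q x y z : V, x ≠ y → y ≠ z → x ≠ z → ReflTransGen D p q → ReflTransGen D q p →
      p ≠ q → ReflTransGen D p x → ReflTransGen D p y → ReflTransGen D p z →
      (∀ u, ReflTransGen D p u → u = x ∨ u = y ∨ u = z) ∨ D p q := by
    intro p q x y z hxy hyz hxz rpq rqp hpq rx ry rz
    by_contra! hcon
    obtain ⟨⟨u, ru, hu⟩, hn⟩ := hcon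
    obtain ⟨m, hpm, hmq⟩ := exists_middle hloop hs rpq hpq hn
    have hmp : D m p := hc m p hpm (ReflTransGen.head hmq rqp)
    have hqm : D q m := hc q m hmq (rqp.tail hpm)
    have hn' : ¬ D q p := fun e => hn (hc p q e rpq)
    have hcl : ∀ s, ReflTransGen D p s → s = p ∨ s = m ∨ s = q := by
      intro s hsr
      induction hsr with
      | refl => simp
      | @tail s s' _ hss ih =>
        rcases ih with rfl | rfl | rfl
        · have := hs q m s hqm hmp hpq.symm hn' s' (Or.inr hss)
          tauto
        · exact hs p s q hpm hmq hpq hn s' (Or.inl hss)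
        · exact hs p m s hpm hmq hpq hn s' (Or.inr hss)
    have h1 := hcl x rx
    have h2 := hcl y ry
    have h3 := hcl z rz
    have h4 := hcl u ru
    clear rpq rqp rx ry rz ru hcl hpm hmq hmp hqm hn hn' hs hc h hloop
    grind
  apply triplesClosed_of_step
  intro a b c d hab hbc hac rab rbc rca hcd
  have rcd : ReflTransGen D c d := .single hcd
  rcases adj a c a b c hab hbc hac (rab.trans rbc) rca hac .refl rab (rab.trans rbc) with h1 | h1
  · exact h1 d ((rab.trans rbc).trans rcd)
  rcases adj b a a b c hab hbc hac (rbc.trans rca) rab hab.symm (rbc.trans rca) .refl rbc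
    with h2 | h2
  · exact h2 d (rbc.trans rcd)
  rcases adj c b a b c hab hbc hac (rca.trans rab) rbc hbc.symm rca (rca.trans rab) .refl
    with h3 | h3
  · exact h3 d rcd
  by_contra! hne
  exact h.no_triangle_exit hloop h1 h2 h3 hcd hne.1 hne.2.1

end Necessity

section Gaps

variable {D : V → V → Prop}

/-- `v → m → t` is a directed path in `D` whose end points are at directed distance two. -/
structure IsGap (D : V → V → Prop) (v m t : V) : Prop where
  ne : v ≠ t
  not_adj : ¬ D v t
  left : D v m
  right : D m t

lemma IsGap.not_back {v m t : V} (g : IsGap D v m t) (hc : ClosedDigraph D) : ¬ D t v := fun h =>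
  g.not_adj (hc v t h (.head g.left (.single g.right)))

lemma IsGap.reach {v m t y : V} (g : IsGap D v m t) (hconn : ConnectedDigraph D)
    (hloop : ∀ v, ¬ D v v) (hc : ClosedDigraph D) (hs : StarCond D) (ht : TriplesClosed D)
    (h : ReflTransGen D m y) : y = v ∨ y = m ∨ y = t := by
  have hst := hs v m t g.left g.right g.ne g.not_adj
  have nvm : v ≠ m := fun e => hloop m (by have := g.left; rwa [e] at this)
  have nmt : m ≠ t := fun e => hloop t (by have := g.right; rwa [e] at this)
  have hv : D m v → ∀ z, D v z → z = v ∨ z = m ∨ z = t := by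
    intro hmv z hvz
    by_contra! hne
    obtain ⟨zv, zm, zt⟩ := hne
    have hmz : ¬ D m z := fun e => by
      rcases hst z (Or.inl e) with e | e | e <;> contradiction
    have hz := hs m v z hmv hvz zm.symm hmz
    rcases hconn z t with hzt | htz
    · rcases ReflTransGen.cases_head hzt with e | ⟨y, hzy, -⟩
      · exact zt e
      have hzm : ReflTransGen D z m := by
        rcases hz y (Or.inr hzy) with rfl | rfl | rfl
        · exact .single hzy
        · exact .tail (.single hzy) g.left
        · exact absurd hzy (hloop _)
      rcases ht z v m t zv nvm zm (hzm.tail hmv) (.single g.left) (.tail (.single hmv) hvz)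
        (.single g.right) with e | e | e
      · exact zt e.symm
      · exact g.ne e.symm
      · exact nmt e.symm
    · rcases ReflTransGen.cases_head htz with e | ⟨y, hty, -⟩
      · exact zt e.symm
      have htm : ReflTransGen D t m := by
        rcases hst y (Or.inr hty) with rfl | rfl | rfl
        · exact absurd hty (g.not_back hc)
        · exact .single hty
        · exact absurd hty (hloop _)
      rcases ht t m v z nmt.symm nvm.symm g.ne.symm htm (.single hmv)
        (.tail (.single g.left) g.right) (.single hvz) with e | e | e
      · exact zt e
      · exact zm e
      · exact zv e
  suffices H : (y = v ∧ D m v) ∨ y = m ∨ y = t by tauto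
  induction h with
  | refl => simp
  | @tail y z _ hyz ih =>
    have step : z = v ∨ z = m ∨ z = t := by
      rcases ih with ⟨rfl, hmv⟩ | rfl | rfl
      · exact hv hmv z hyz
      · exact hst z (Or.inl hyz)
      · exact hst z (Or.inr hyz)
    rcases step with rfl | e | e
    · left
      refine ⟨rfl, ?_⟩
      rcases ih with ⟨rfl, hmv⟩ | rfl | rfl
      · exact hmv
      · exact hyz
      · exact absurd hyz (g.not_back hc)
    · exact Or.inr (Or.inl e)
    · exact Or.inr (Or.inr e)

lemma IsGap.middle_unique {v m p b t : V} (g : IsGap D v m t) (g' : IsGap D p b t)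
    (hconn : ConnectedDigraph D)
    (hloop : ∀ v, ¬ D v v) (hc : ClosedDigraph D) (hs : StarCond D) (ht : TriplesClosed D) :
    b = m := by
  rcases hconn m b with h | h
  · rcases g.reach hconn hloop hc hs ht h with e | e | e
    · exact absurd (e ▸ g'.right) g.not_adj
    · exact e
    · exact absurd (e ▸ g'.right) (hloop _)
  · rcases g'.reach hconn hloop hc hs ht h with e | e | e
    · exact absurd (e ▸ g.right) g'.not_adj
    · exact e.symm
    · exact absurd (e ▸ g.right) (hloop _)

/-- The possible positions of the image of the initial vertex of a gap ending in `t`, relative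
to the image of the middle vertex `m` or of the end vertex `t`. -/
def GapInv (D : V → V → Prop) (m t p q : V) : Prop :=
  ¬ ReflTransGen D p t ∨ p = q ∨ (p ≠ t ∧ ¬ D p t ∧ (q = m ∨ q = t)) ∨ (p = m ∧ q = t)

lemma IsGap.inv_step [DecidableEq V] {v m t : V} (g : IsGap D v m t)
    (hconn : ConnectedDigraph D)
    (hloop : ∀ v, ¬ D v v) (hc : ClosedDigraph D) (hs : StarCond D) (ht : TriplesClosed D)
    {p q a b : V} (hab : D a b) (h : GapInv D m t p q) :
    GapInv D m t (arcMap a b p) (arcMap a b q) := by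
  by_cases hpt : ReflTransGen D (arcMap a b p) t
  swap
  · exact Or.inl hpt
  have hpt' : ReflTransGen D p t := by
    by_cases hpa : p = a
    · refine ReflTransGen.head (hpa ▸ hab : D p b) ?_
      simpa [arcMap, hpa] using hpt
    · simpa [arcMap, hpa] using hpt
  have hstar : ∀ p', p' ≠ t → ¬ D p' t → ReflTransGen D p' t → D p' m ∧
      ∀ u, (D m u ∨ D t u) → u = p' ∨ u = m ∨ u = t := by
    intro p' h1 h2 h3
    obtain ⟨b', hb1, hb2⟩ := exists_middle hloop hs h3 h1 h2
    obtain rfl := g.middle_unique ⟨h1, h2, hb1, hb2⟩ hconn hloop hc hs ht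
    exact ⟨hb1, hs p' b' t hb1 hb2 h1 h2⟩
  have huniq : ∀ p' b', p' ≠ t → ¬ D p' t → D p' b' → D b' t → b' = m := fun p' b' h1 h2 h3 h4 =>
    g.middle_unique ⟨h1, h2, h3, h4⟩ hconn hloop hc hs ht
  have nvm : v ≠ m := fun e => hloop m (by have := g.left; rwa [e] at this)
  have nmt : m ≠ t := fun e => hloop t (by have := g.right; rwa [e] at this)
  have hmt := g.right
  right
  rcases h with h | rfl | ⟨h1, h2, h3⟩ | ⟨rfl, rfl⟩
  · exact absurd hpt' h
  · exact Or.inl rfl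
  · obtain ⟨hpm, hst⟩ := hstar p h1 h2 hpt'
    by_cases hpa : p = a
    · subst hpa
      have hqp : q ≠ p := by rintro rfl; rcases h3 with rfl | rfl <;> contradiction
      simp only [arcMap, if_true, if_neg hqp]
      have hbt : b ≠ t := fun e => h2 (e ▸ hab)
      by_cases hb : D b t
      · have := huniq p b h1 h2 hab hb
        subst this
        tauto
      · tauto
    · simp only [arcMap, if_neg hpa]
      by_cases hqa : q = a
      · subst hqa
        simp only [if_true]
        have : D m b ∨ D t b := by rcases h3 with rfl | rfl <;> simp [hab]
        rcases hst b this with rfl | rfl | rfl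
        · exact Or.inl rfl
        · exact Or.inr (Or.inl ⟨h1, h2, Or.inl rfl⟩)
        · exact Or.inr (Or.inl ⟨h1, h2, by simp⟩)
      · simp only [if_neg hqa]
        exact Or.inr (Or.inl ⟨h1, h2, h3⟩)
  · have hst := hs v p q g.left g.right g.ne g.not_adj
    by_cases hpa : p = a
    · subst hpa
      simp only [arcMap, if_true, if_neg nmt.symm]
      rcases hst b (Or.inl hab) with rfl | rfl | rfl
      · exact Or.inr (Or.inl ⟨g.ne, g.not_adj, by simp⟩)
      · exact absurd hab (hloop _)
      · exact Or.inl rfl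
    · simp only [arcMap, if_neg hpa]
      by_cases hqa : q = a
      · subst hqa
        simp only [if_true]
        rcases hst b (Or.inr hab) with rfl | rfl | rfl
        · exact absurd hab (g.not_back hc)
        · exact Or.inl rfl
        · exact absurd hab (hloop _)
      · simp [hqa]

lemma IsGap.inv_wordEval [DecidableEq V] {v m t z : V} (g : IsGap D v m t)
    (hconn : ConnectedDigraph D)
    (hloop : ∀ v, ¬ D v v) (hc : ClosedDigraph D) (hs : StarCond D) (ht : TriplesClosed D)
    (hz : z = m ∨ z = t) (w : List (V × V)) (hw : ∀ e ∈ w, D e.1 e.2) :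
    GapInv D m t (wordEval w v) (wordEval w z) := by
  refine wordEval_induction (D := D) (fun f => GapInv D m t (f v) (f z)) ?_ ?_ w hw
  · exact Or.inr (Or.inr (Or.inl ⟨g.ne, g.not_adj, hz⟩))
  · intro f a b hab h
    exact g.inv_step hconn hloop hc hs ht hab h

lemma IsGap.image_eq [DecidableEq V] {v m t z : V} (g : IsGap D v m t)
    (hconn : ConnectedDigraph D)
    (hloop : ∀ v, ¬ D v v) (hc : ClosedDigraph D) (hs : StarCond D) (ht : TriplesClosed D)
    (hz : z = m ∨ z = t) (w : List (V × V)) (hw : ∀ e ∈ w, D e.1 e.2) (hv : wordEval w v = t) :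
    wordEval w z = t := by
  have h := g.inv_wordEval hconn hloop hc hs ht hz w hw
  rw [hv] at h
  rcases h with h | h | h | ⟨h, -⟩
  · exact absurd .refl h
  · exact h.symm
  · exact absurd rfl h.1
  · exact absurd (h ▸ g.right) (hloop _)

lemma IsGap.end_unique {α : V → V} {v m t v' m' t' : V} (g : IsGap D v m t)
    (g' : IsGap D v' m' t') (hconn : ConnectedDigraph D)
    (hloop : ∀ v, ¬ D v v) (hc : ClosedDigraph D) (hs : StarCond D) (ht : TriplesClosed D)
    (hv : α v = t) (hm : α m = t) (hαt : α t = t)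
    (hv' : α v' = t') (hm' : α m' = t') (hαt' : α t' = t') : t = t' := by
  rcases hconn t t' with h | h
  · rcases g.reach hconn hloop hc hs ht (.head g.right h) with e | e | e
    · rw [e, hv] at hαt'; rw [e, hαt']
    · rw [e, hm] at hαt'; rw [e, hαt']
    · exact e.symm
  · rcases g'.reach hconn hloop hc hs ht (.head g'.right h) with e | e | e
    · rw [e, hv'] at hαt; rw [e, hαt]
    · rw [e, hm'] at hαt; rw [e, hαt]
    · exact e

end Gaps

section Sufficiency

variable [DecidableEq V] {D : V → V → Prop}

/-- If a product of arcs permutes a convex set of vertices, it fixes the set pointwise. -/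
lemma eq_of_injOn_convex (hloop : ∀ v, ¬ D v v) {Q : Set V}
    (hQ : ∀ q ∈ Q, ∀ q' ∈ Q, ∀ y, ReflTransGen D q y → ReflTransGen D y q' → y ∈ Q)
    (w : List (V × V)) (hw : ∀ e ∈ w, D e.1 e.2)
    (hmaps : ∀ q ∈ Q, wordEval w q ∈ Q) (hinj : Set.InjOn (wordEval w) Q) :
    ∀ q ∈ Q, wordEval w q = q := by
  have key := wordEval_induction (D := D) (fun f => (∀ q ∈ Q, f q = q) ∨
    (∃ q ∈ Q, ∃ q' ∈ Q, q ≠ q' ∧ f q = f q') ∨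
    (∃ q ∈ Q, ∀ q' ∈ Q, ¬ ReflTransGen D (f q) q')) (Or.inl fun q _ => rfl) ?_ w hw
  · rcases key with h | ⟨q, hq, q', hq', hne, h⟩ | ⟨q, hq, h⟩
    · exact h
    · exact absurd (hinj hq hq' h) hne
    · exact absurd .refl (h _ (hmaps q hq))
  · rintro f a b hab (h | ⟨q, hq, q', hq', hne, h⟩ | ⟨q, hq, h⟩)
    · by_cases ha : a ∈ Q
      · right
        by_cases hb : b ∈ Q
        · left
          refine ⟨a, ha, b, hb, fun e => hloop b (e ▸ hab), ?_⟩
          simp [h a ha, h b hb, arcMap]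
        · right
          refine ⟨a, ha, fun q' hq' hr => hb (hQ a ha q' hq' b (.single hab) ?_)⟩
          simpa [h a ha, arcMap] using hr
      · left
        intro q hq
        have : q ≠ a := fun e => ha (e ▸ hq)
        simp [h q hq, arcMap, this]
    · exact Or.inr (Or.inl ⟨q, hq, q', hq', hne, by simp [h]⟩)
    · refine Or.inr (Or.inr ⟨q, hq, fun q' hq' hr => h q' hq' ?_⟩)
      by_cases hfa : f q = a
      · refine .head (hfa ▸ hab : D (f q) b) ?_
        simpa [arcMap, hfa] using hr
      · simpa [arcMap, hfa] using hr

lemma adj_or_isGap (hconn : ConnectedDigraph D)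
    (hloop : ∀ v, ¬ D v v) (hc : ClosedDigraph D) (hs : StarCond D) (ht : TriplesClosed D)
    (w : List (V × V)) (hw : ∀ e ∈ w, D e.1 e.2) {v : V} (hv : wordEval w v ≠ v)
    (hn : ¬ D v (wordEval w v)) :
    ∃ m, IsGap D v m (wordEval w v) ∧ wordEval w m = wordEval w v ∧
      wordEval w (wordEval w v) = wordEval w v := by
  obtain ⟨m, h1, h2⟩ := exists_middle hloop hs (reflTransGen_wordEval w hw v) hv.symm hn
  have g : IsGap D v m (wordEval w v) := ⟨hv.symm, hn, h1, h2⟩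
  exact ⟨m, g, g.image_eq hconn hloop hc hs ht (Or.inl rfl) w hw rfl,
    g.image_eq hconn hloop hc hs ht (Or.inr rfl) w hw rfl⟩

/-- If a product of arcs sends `a ↦ b`, `b ↦ a`, `c ↦ a`, where `a`, `b`, `c` belong to the same
strong component, then this component is a complete digraph. -/
lemma triangle_of_swap (hconn : ConnectedDigraph D)
    (hloop : ∀ v, ¬ D v v) (hc : ClosedDigraph D) (hs : StarCond D) (ht : TriplesClosed D)
    (w : List (V × V)) (hw : ∀ e ∈ w, D e.1 e.2) {a b c : V} (hab : a ≠ b) (hac : a ≠ c)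
    (hbc : b ≠ c) (ha : wordEval w a = b) (hb : wordEval w b = a) (hca : wordEval w c = a)
    (rac : ReflTransGen D a c) : D c a ∧ D a b ∧ D b c := by
  have adj : ∀ v t, wordEval w v = t → v ≠ t → wordEval w t ≠ t → D v t := by
    rintro v t rfl hne hne'
    by_contra hn
    obtain ⟨m, -, -, h⟩ := adj_or_isGap hconn hloop hc hs ht w hw hne.symm hn
    exact hne' h
  have dca : D c a := adj c a hca hac.symm (by rw [ha]; exact hab.symm)
  have dab : D a b := adj a b ha hab (by rw [hb]; exact hab)
  have dba : D b a := adj b a hb hab.symm (by rw [ha]; exact hab.symm)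
  have dac : D a c := hc a c dca rac
  refine ⟨dca, dab, ?_⟩
  by_contra hn
  have g : IsGap D b a c := ⟨hbc, hn, dba, dac⟩
  have h := g.inv_wordEval hconn hloop hc hs ht (Or.inl rfl) w hw
  rw [hb, ha] at h
  rcases h with h | h | ⟨-, h, -⟩ | ⟨-, h⟩
  · exact h rac
  · exact hab h
  · exact h dac
  · exact hbc h

/-- An invariant set without fixed points of a product of arcs contains two points swapped by
it, and these lie in a strong component which is a complete digraph on three vertices. -/
lemma exists_triangle [Finite V] (hconn : ConnectedDigraph D)
    (hloop : ∀ v, ¬ D v v) (hc : ClosedDigraph D) (hs : StarCond D) (ht : TriplesClosed D)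
    (w : List (V × V)) (hw : ∀ e ∈ w, D e.1 e.2) {C : Finset V} (hne : C.Nonempty)
    (hinv : ∀ v ∈ C, wordEval w v ∈ C) (hfix : ∀ v ∈ C, wordEval w v ≠ v) :
    ∃ a b c, a ∈ C ∧ wordEval w a = b ∧ wordEval w b = a ∧ wordEval w c = a ∧
      D c a ∧ D a b ∧ D b c := by
  set α := wordEval w with hα
  have hr : ∀ x, ReflTransGen D x (α x) := reflTransGen_wordEval w hw
  have hswap : ∃ a ∈ C, α (α a) = a := by
    obtain ⟨x, hx⟩ := hne
    obtain ⟨i, j, hij, he⟩ := Finite.exists_ne_map_eq_of_infinite fun i : ℕ => α^[i] x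
    wlog hlt : i < j generalizing i j
    · exact this j i hij.symm he.symm (by omega)
    have hC : ∀ k, α^[k] x ∈ C := by
      intro k
      induction k with
      | zero => exact hx
      | succ k ih => rw [Function.iterate_succ_apply']; exact hinv _ ih
    have hreach : ∀ k y, ReflTransGen D y (α^[k] y) := by
      intro k
      induction k with
      | zero => exact fun y => .refl
      | succ k ih =>
        intro y
        rw [Function.iterate_succ_apply']
        exact (ih y).trans (hr _)
    set a := α^[i] x with ha
    have haC : a ∈ C := hC i
    have hper : α^[j - i] a = a := by
      rw [ha, ← Function.iterate_add_apply, Nat.sub_add_cancel hlt.le]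
      exact he.symm
    have hback : ReflTransGen D (α (α a)) a := by
      have h1 : α^[(j - i) * 2] a = a := by
        rw [Function.iterate_mul, Function.iterate_succ_apply, Function.iterate_one, hper, hper]
      have h2 : (j - i) * 2 = ((j - i) * 2 - 2) + 2 := by omega
      rw [h2, Function.iterate_add_apply] at h1
      have := hreach ((j - i) * 2 - 2) (α^[2] a)
      rw [h1] at this
      exact this
    by_cases h2 : α (α a) = a
    · exact ⟨a, haC, h2⟩
    have n1 := hfix a haC
    have n2 := hfix _ (hinv a haC)
    have n3 := hfix _ (hinv _ (hinv a haC))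
    rcases ht a (α a) (α (α a)) (α (α (α a))) (Ne.symm n1) (Ne.symm n2) (Ne.symm h2) (hr _) (hr _)
      hback (hr _) with h3 | h3 | h3
    · exfalso
      refine n1 (eq_of_injOn_convex hloop (Q := {a, α a, α (α a)}) ?_ w hw ?_ ?_ a (by simp))
      · intro q hq q' hq' y hqy hyq
        have : ReflTransGen D (α (α a)) y := by
          rcases hq with rfl | rfl | rfl
          · exact hback.trans hqy
          · exact hback.trans ((hr _).trans hqy)
          · exact hqy
        simpa using ht a (α a) (α (α a)) y (Ne.symm n1) (Ne.symm n2) (Ne.symm h2) (hr _) (hr _)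
          hback this
      · rintro q (rfl | rfl | rfl) <;> simp [← hα, h3]
      · rintro q (rfl | rfl | rfl) q' (rfl | rfl | rfl) hqq <;> simp only [← hα] at hqq <;>
          first | rfl | (exfalso; clear_value α a; grind)
    · exact ⟨α a, hinv a haC, h3⟩
    · exact absurd h3 n3
  obtain ⟨a, haC, hab'⟩ := hswap
  obtain ⟨b, hb⟩ : ∃ b, α a = b := ⟨_, rfl⟩
  rw [hb] at hab'
  have hbC : b ∈ C := hb ▸ hinv a haC
  have nab : a ≠ b := fun e => hfix a haC (hb.trans e.symm)
  have rab : ReflTransGen D a b := hb ▸ hr a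
  have rba : ReflTransGen D b a := by simpa [hab'] using hr b
  have hthird : ∃ c, a ≠ c ∧ b ≠ c ∧ ReflTransGen D a c ∧ ReflTransGen D c a := by
    by_contra! hcon
    refine hfix a haC (eq_of_injOn_convex hloop (Q := {a, b}) ?_ w hw ?_ ?_ a (by simp))
    · intro q hq q' hq' y hqy hyq
      by_contra hy
      simp only [Set.mem_insert_iff, Set.mem_singleton_iff, not_or] at hy
      refine hcon y (Ne.symm hy.1) (Ne.symm hy.2) ?_ ?_
      · rcases hq with rfl | rfl
        · exact hqy
        · exact rab.trans hqy
      · rcases hq' with rfl | rfl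
        · exact hyq
        · exact hyq.trans rba
    · rintro q (rfl | rfl)
      · simp [← hα, hb]
      · simp [← hα, hab']
    · rintro q (rfl | rfl) q' (rfl | rfl) hqq <;> simp only [← hα] at hqq
      · rfl
      · exact absurd (hab'.symm.trans (hqq.symm.trans hb)) nab
      · exact absurd (hab'.symm.trans (hqq.trans hb)) nab
      · rfl
  obtain ⟨c, nac, nbc, rac, rca⟩ := hthird
  rcases ht a b c (α c) nab nbc nac rab (rba.trans rac) rca (hr c) with h | h | h
  · exact ⟨a, b, c, haC, hb, hab', h,
      triangle_of_swap hconn hloop hc hs ht w hw nab nac nbc hb hab' h rac⟩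
  · exact ⟨b, a, c, hbC, hab', hb, h,
      triangle_of_swap hconn hloop hc hs ht w hw nab.symm nbc nac hab' hb h (rba.trans rac)⟩
  · exfalso
    refine hfix a haC (eq_of_injOn_convex hloop (Q := {a, b, c}) ?_ w hw ?_ ?_ a (by simp))
    · intro q hq q' hq' y hqy hyq
      have : ReflTransGen D c y := by
        rcases hq with rfl | rfl | rfl
        · exact rca.trans hqy
        · exact rca.trans (rab.trans hqy)
        · exact hqy
      simpa using ht a b c y nab nbc nac rab (rba.trans rac) rca this
    · rintro q (rfl | rfl | rfl)
      · simp [← hα, hb]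
      · simp [← hα, hab']
      · simp [← hα, h]
    · rintro q (rfl | rfl | rfl) q' (rfl | rfl | rfl) hqq <;> simp only [← hα] at hqq <;>
        first | rfl | (exfalso; clear_value α; clear rab rba rac rca hr; grind)

/-- There is a word of length `|S|` in the arcs of `D` which acts as `α` on `S` and fixes all
other points. -/
def Realizes (D : V → V → Prop) (α : V → V) (S : Finset V) : Prop :=
  ∃ w : List (V × V), (∀ e ∈ w, D e.1 e.2) ∧ w.length = S.card ∧
    ∀ x, wordEval w x = if x ∈ S then α x else x

lemma Realizes.insert {α : V → V} {S : Finset V} (h : Realizes D α S) {v y : V} (hv : v ∉ S)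
    (hvy : D v y) (h1 : y ∈ S → α y = α v) (h2 : y ∉ S → y = α v) :
    Realizes D α (insert v S) := by
  obtain ⟨w, hw, hlen, hev⟩ := h
  refine ⟨(v, y) :: w, ?_, ?_, ?_⟩
  · simpa [hvy] using fun a b h => hw (a, b) h
  · rw [List.length_cons, hlen, Finset.card_insert_of_notMem hv]
  · intro x
    rw [wordEval_cons, hev]
    by_cases hx : x = v
    · subst hx
      by_cases hy : y ∈ S
      · simp [arcMap, hy, h1 hy]
      · have hα : α x ∉ S := h2 hy ▸ hy
        simp [arcMap, h2 hy, hα]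
    · simp [arcMap, hx]

lemma Realizes.union {α : V → V} {S : Finset V} (h : Realizes D α S) (U : Finset V)
    (hU : ∀ v ∈ U, ∃ y ∈ S, D v y ∧ α y = α v) : Realizes D α (U ∪ S) := by
  induction U using Finset.induction_on with
  | empty => simpa using h
  | insert v U _ ih =>
    have ih' := ih fun u hu => hU u (Finset.mem_insert_of_mem hu)
    rw [Finset.insert_union]
    by_cases hv : v ∈ U ∪ S
    · rwa [Finset.insert_eq_of_mem hv]
    · obtain ⟨y, hy, hvy, he⟩ := hU v (Finset.mem_insert_self _ _)
      exact ih'.insert hv hvy (fun _ => he) fun hn => absurd (Finset.mem_union_right _ hy) hn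

lemma realizes_of_acyclic {α : V → V} (R : Finset V) (hR : ∀ v ∈ R, D v (α v))
    (hac : ∀ C ⊆ R, C.Nonempty → ∃ v ∈ C, α v ∉ C) : Realizes D α R := by
  induction R using Finset.strongInduction with
  | H R ih =>
    rcases R.eq_empty_or_nonempty with rfl | hne
    · exact ⟨[], by simp, by simp, by simp⟩
    · obtain ⟨v, hv, hαv⟩ := hac R (Finset.Subset.refl _) hne
      have h := ih (R.erase v) (Finset.erase_ssubset hv)
        (fun u hu => hR u (Finset.mem_of_mem_erase hu))
        (fun C hC => hac C (hC.trans (Finset.erase_subset _ _)))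
      have := h.insert (v := v) (y := α v) (by simp) (hR v hv)
        (fun hy => absurd (Finset.mem_of_mem_erase hy) hαv) (fun _ => rfl)
      rwa [Finset.insert_erase hv] at this

variable [Fintype V]

lemma realizes_moved_of_isGap (hconn : ConnectedDigraph D)
    (hloop : ∀ v, ¬ D v v) (hc : ClosedDigraph D) (hs : StarCond D) (ht : TriplesClosed D)
    (w : List (V × V)) (hw : ∀ e ∈ w, D e.1 e.2) {v₀ m t : V} (g : IsGap D v₀ m t)
    (hv₀ : wordEval w v₀ = t) (hm : wordEval w m = t) (hαt : wordEval w t = t) :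
    Realizes D (wordEval w) (moved (wordEval w)) := by
  classical
  set α := wordEval w with hα
  set R := (moved α).filter fun v => D v (α v) ∧ v ≠ m with hRdef
  have hRreal : Realizes D α R := by
    refine realizes_of_acyclic R (fun v hv => (Finset.mem_filter.1 hv).2.1) ?_
    intro C hCR hne
    by_contra! hinv
    obtain ⟨a, b, c, -, hab, hba, -, dca, dab, dbc⟩ := exists_triangle hconn hloop hc hs ht w hw
      hne hinv fun v hv => mem_moved.1 (Finset.mem_filter.1 (hCR hv)).1
    rw [← hα] at hab hba
    have nab : a ≠ b := fun e => hloop b (e ▸ dab)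
    have nbc : b ≠ c := fun e => hloop c (e ▸ dbc)
    have nca : c ≠ a := fun e => hloop a (e ▸ dca)
    have hma : ReflTransGen D m a := by
      rcases hconn m a with h | h
      · exact h
      · rcases ht b c a m nbc nca nab.symm (.single dbc) (.single dca) (.single dab) h
          with rfl | rfl | rfl
        · exact .head dbc (.single dca)
        · exact .single dca
        · exact .refl
    have hαa : α a = t := by
      rcases g.reach hconn hloop hc hs ht hma with rfl | rfl | rfl <;> assumption
    have hαb : α b = t := by
      rcases g.reach hconn hloop hc hs ht (hma.tail dab) with rfl | rfl | rfl <;> assumption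
    exact nab (hba.symm.trans (hαb.trans (hαa.symm.trans hab)))
  have nmt : m ≠ t := fun e => hloop t (by have := g.right; rwa [e] at this)
  have hins : Realizes D α (insert m R) := by
    refine hRreal.insert (y := t) (by simp [hRdef]) g.right (fun h => ?_) fun _ => hm.symm
    exact absurd hαt (mem_moved.1 (Finset.mem_filter.1 h).1)
  have hun := hins.union ((moved α).filter fun v => ¬ D v (α v)) ?_
  · convert hun using 1
    ext v
    have hmt : α m ≠ m := by rw [hm]; exact nmt.symm
    simp only [hRdef, Finset.mem_union, Finset.mem_insert, Finset.mem_filter, mem_moved]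
    by_cases hvm : v = m
    · subst hvm
      simp [hmt]
    · tauto
  · intro v hv
    obtain ⟨hv1, hv2⟩ := Finset.mem_filter.1 hv
    obtain ⟨m', g', hm', ht'⟩ := adj_or_isGap hconn hloop hc hs ht w hw (mem_moved.1 hv1) hv2
    have he : t = α v := g.end_unique g' hconn hloop hc hs ht hv₀ hm hαt rfl hm' ht'
    rw [← hα, ← he] at g'
    have hmm := g.middle_unique g' hconn hloop hc hs ht
    exact ⟨m, Finset.mem_insert_self _ _, hmm ▸ g'.left, hm.trans he⟩

lemma realizes_moved (hconn : ConnectedDigraph D)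
    (hloop : ∀ v, ¬ D v v) (hc : ClosedDigraph D) (hs : StarCond D) (ht : TriplesClosed D)
    (w : List (V × V)) (hw : ∀ e ∈ w, D e.1 e.2) :
    Realizes D (wordEval w) (moved (wordEval w)) := by
  by_cases hgap : ∃ v, wordEval w v ≠ v ∧ ¬ D v (wordEval w v)
  · obtain ⟨v, hv, hn⟩ := hgap
    obtain ⟨m, g, h1, h2⟩ := adj_or_isGap hconn hloop hc hs ht w hw hv hn
    exact realizes_moved_of_isGap hconn hloop hc hs ht w hw g rfl h1 h2
  push Not at hgap
  by_cases hac : ∀ C ⊆ moved (wordEval w), C.Nonempty → ∃ v ∈ C, wordEval w v ∉ C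
  · exact realizes_of_acyclic _ (fun v hv => hgap v (mem_moved.1 hv)) hac
  push Not at hac
  obtain ⟨C, hC, hne, hinv⟩ := hac
  obtain ⟨a, b, c, -, hab, hba, hca, dca, dab, dbc⟩ := exists_triangle hconn hloop hc hs ht w hw
    hne hinv fun v hv => mem_moved.1 (hC hv)
  have nab : a ≠ b := fun e => hloop b (e ▸ dab)
  have nbc : b ≠ c := fun e => hloop c (e ▸ dbc)
  have nca : c ≠ a := fun e => hloop a (e ▸ dca)
  set R := moved (wordEval w) \ {a, b, c} with hRdef
  have hR : ∀ v ∈ R, v ∈ moved (wordEval w) ∧ v ≠ b ∧ v ≠ c ∧ v ≠ a := by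
    intro v hv
    simp only [hRdef, Finset.mem_sdiff, Finset.mem_insert, Finset.mem_singleton] at hv
    tauto
  have haR : a ∉ R := fun h => (hR a h).2.2.2 rfl
  have hbR : b ∉ R := fun h => (hR b h).2.1 rfl
  have hcR : c ∉ R := fun h => (hR c h).2.2.1 rfl
  have hRreal : Realizes D (wordEval w) R := by
    refine realizes_of_acyclic R (fun v hv => hgap v (mem_moved.1 (hR v hv).1)) ?_
    intro C' hC' hne'
    by_contra! hinv'
    obtain ⟨a', b', c', haC, -, -, -, dca', dab', dbc'⟩ := exists_triangle hconn hloop hc hs ht w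
      hw hne' hinv' fun v hv => mem_moved.1 (hR v (hC' hv)).1
    have nab' : a' ≠ b' := fun e => hloop b' (e ▸ dab')
    have nbc' : b' ≠ c' := fun e => hloop c' (e ▸ dbc')
    have nca' : c' ≠ a' := fun e => hloop a' (e ▸ dca')
    have hreach : ReflTransGen D a a' := by
      rcases hconn a a' with h | h
      · exact h
      · rcases ht b' c' a' a nbc' nca' nab'.symm (.single dbc') (.single dca') (.single dab') h
          with rfl | rfl | rfl
        · exact .head dbc' (.single dca')
        · exact .single dca'
        · exact .refl
    obtain ⟨-, h1, h2, h3⟩ := hR a' (hC' haC)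
    rcases ht b c a a' nbc nca nab.symm (.single dbc) (.single dca) (.single dab) hreach
      with e | e | e <;> contradiction
  have s1 := hRreal.insert (v := c) (y := a) hcR dca (fun h => absurd h haR) fun _ => hca.symm
  have s2 := s1.insert (v := a) (y := b) (by simp [nca.symm, haR]) dab
    (fun h => absurd h (by simp [nbc, hbR])) fun _ => hab.symm
  have s3 := s2.insert (v := b) (y := c) (by simp [nab.symm, nbc, hbR]) dbc
    (fun _ => hca.trans hba.symm) fun h => absurd (by simp) h
  convert s3 using 1
  ext v
  simp only [hRdef, Finset.mem_insert, Finset.mem_sdiff, Finset.mem_singleton, mem_moved]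
  by_cases h1 : v = a
  · subst h1; simp [hab, nab.symm]
  by_cases h2 : v = b
  · subst h2; simp [hba, nab]
  by_cases h3 : v = c
  · subst h3; simp [hca, nca.symm]
  tauto

lemma isTight_of_conditions (hconn : ConnectedDigraph D)
    (hloop : ∀ v, ¬ D v v) (hc : ClosedDigraph D) (hs : StarCond D) (ht : TriplesClosed D) :
    IsTight D := by
  rintro _ ⟨w, -, hw, rfl⟩
  obtain ⟨w', hw', hlen, hev⟩ := realizes_moved hconn hloop hc hs ht w hw
  have he : wordEval w' = wordEval w := by
    funext x
    rw [hev]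
    split_ifs with hx
    · rfl
    · simpa [eq_comm] using hx
  rw [← he] at hlen ⊢
  exact arcLen_eq w' hw' hlen

end Sufficiency

end ArcWords

/-- for a connected simple digraph `D` on `{1,…,n}`, `n ≥ 3`,
`ℓ(D, α) = n − fix(α)` for all `α ∈ ⟨D⟩` iff `D` is closed and satisfies (★) and (★★). -/
theorem stmt10 (n : ℕ) (hn : 3 ≤ n) (D : Fin n → Fin n → Prop) (hloop : ∀ v, ¬ D v v)
    (hconn : ConnectedDigraph D) :
    (∀ α : Fin n → Fin n, InGen D α → arcLen D α = n - fixCnt α) ↔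
      (ClosedDigraph D ∧ StarCond D ∧ StarStarCond D) := by
  have key : (∀ α : Fin n → Fin n, InGen D α → arcLen D α = n - fixCnt α) ↔
      ArcWords.IsTight D := by
    simp [ArcWords.IsTight]
  rw [key]
  constructor
  · intro h
    exact ⟨h.closedDigraph hloop, h.starCond hloop, (h.triplesClosed hloop).starStarCond⟩
  · rintro ⟨hc, hs, hss⟩
    exact ArcWords.isTight_of_conditions hconn hloop hc hs (ArcWords.triplesClosed_of_starStarCond hss)
end
end
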